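/- arXiv:1908.01967 — 9 statements merged into one kernel-verified Lean document; each statement's English description precedes it below -/
import Mathlib

section
/- Let g = E du² + 2F du dv + G dv² be a metric on an open set U ⊆ ℝ², λ := EG − F², and let p ∈ U satisfy λ(p) = 0 and dλ(p) ≠ 0. Let η : U → ℝ² be a smooth vector field with η(p) ≠ 0 and η(p) ∈ 𝒩ₚ (η(p) is a null vector at p). Then the following are equivalent: (i) the directional derivative dλ_p(η(p)) is nonzero; (ii) the directional derivative at p, in the direction η(p), of the function q ↦ g_q(η(q), η(q)) is nonzero. (Condition (i) says exactly that the null direction at p is transverse to the semidefinite set {λ = 0}, i.e. that p is a type I semidefinite point.) -/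
noncomputable section

/-- The symmetric bilinear form of the metric `g = E du² + 2F du dv + G dv²` at `q`. -/
def gform (E F G : ℝ × ℝ → ℝ) (q : ℝ × ℝ) (v w : ℝ × ℝ) : ℝ :=
  E q * (v.1 * w.1) + F q * (v.1 * w.2 + v.2 * w.1) + G q * (v.2 * w.2)

/-- A binary quadratic form that annihilates `(a, b) ≠ 0` is a multiple of `(b x - a y)²`. -/
lemma exists_coeff_eq_of_null {e f g a b : ℝ} (hab : a ≠ 0 ∨ b ≠ 0)
    (h₁ : e * a + f * b = 0) (h₂ : f * a + g * b = 0) :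
    ∃ k, e = k * b ^ 2 ∧ f = -(k * (a * b)) ∧ g = k * a ^ 2 := by
  have hs : a ^ 2 + b ^ 2 ≠ 0 := by
    rcases hab with h | h <;> positivity
  refine ⟨(e + g) / (a ^ 2 + b ^ 2), ?_, ?_, ?_⟩ <;> field_simp
  · linear_combination a * h₁ - b * h₂
  · linear_combination b * h₁ + a * h₂
  · linear_combination -a * h₁ + b * h₂

/-- The differential of the discriminant `E G - F²`. -/
lemma hasFDerivAt_discriminant {E F G : ℝ × ℝ → ℝ} {p : ℝ × ℝ}
    (hE : DifferentiableAt ℝ E p) (hF : DifferentiableAt ℝ F p) (hG : DifferentiableAt ℝ G p) :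
    HasFDerivAt (fun q => E q * G q - F q * F q)
      (E p • fderiv ℝ G p + G p • fderiv ℝ E p - (2 * F p) • fderiv ℝ F p) p := by
  refine ((hE.hasFDerivAt.mul hG.hasFDerivAt).sub
    (hF.hasFDerivAt.mul hF.hasFDerivAt)).congr_fderiv ?_
  module

/-- At a point where `η` is null, the derivative of `g(η, η)` does not involve that of `η`. -/
lemma fderiv_gform_self_of_null {E F G : ℝ × ℝ → ℝ} {η : ℝ × ℝ → ℝ × ℝ} {p : ℝ × ℝ}
    (hE : DifferentiableAt ℝ E p) (hF : DifferentiableAt ℝ F p) (hG : DifferentiableAt ℝ G p)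
    (hη : DifferentiableAt ℝ η p) (hnull : ∀ w, gform E F G p (η p) w = 0) (v : ℝ × ℝ) :
    fderiv ℝ (fun q => gform E F G q (η q) (η q)) p v =
      fderiv ℝ E p v * (η p).1 ^ 2 + 2 * fderiv ℝ F p v * ((η p).1 * (η p).2) +
        fderiv ℝ G p v * (η p).2 ^ 2 := by
  have ha := hη.hasFDerivAt.fst
  have hb := hη.hasFDerivAt.snd
  have h := ((hE.hasFDerivAt.mul (ha.mul ha)).add
    (hF.hasFDerivAt.mul ((ha.mul hb).add (hb.mul ha)))).add (hG.hasFDerivAt.mul (hb.mul hb))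
  have hw := hnull (fderiv ℝ η p v)
  simp only [gform] at hw
  refine (congrArg (fun L : ℝ × ℝ →L[ℝ] ℝ => L v) h.fderiv).trans ?_
  simp
  linear_combination 2 * hw

/-- At an admissible semidefinite point `p` of the metric
`g = E du² + 2F du dv + G dv²`, for a smooth vector field `η` with `η(p)` a null
vector at `p`, the condition `dλ_p(η(p)) ≠ 0` is equivalent to the condition that
the directional derivative at `p` in direction `η(p)` of `q ↦ g_q(η(q), η(q))` is
nonzero. -/
theorem typeI_characterization
    (U : Set (ℝ × ℝ)) (hU : IsOpen U)
    (E F G : ℝ × ℝ → ℝ)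
    (hE : ContDiffOn ℝ (⊤ : ℕ∞) E U)
    (hF : ContDiffOn ℝ (⊤ : ℕ∞) F U)
    (hG : ContDiffOn ℝ (⊤ : ℕ∞) G U)
    (p : ℝ × ℝ) (hp : p ∈ U)
    (hlam0 : E p * G p - F p * F p = 0)
    (hdlam : fderiv ℝ (fun q => E q * G q - F q * F q) p ≠ 0)
    (η : ℝ × ℝ → ℝ × ℝ) (hη : ContDiffOn ℝ (⊤ : ℕ∞) η U)
    (hηp : η p ≠ 0)
    (hηnull : ∀ w : ℝ × ℝ, gform E F G p (η p) w = 0) :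
    fderiv ℝ (fun q => E q * G q - F q * F q) p (η p) ≠ 0 ↔
      fderiv ℝ (fun q => gform E F G q (η q) (η q)) p (η p) ≠ 0 := by
  have hUp := hU.mem_nhds hp
  have dE := (hE.contDiffAt hUp).differentiableAt (by simp)
  have dF := (hF.contDiffAt hUp).differentiableAt (by simp)
  have dG := (hG.contDiffAt hUp).differentiableAt (by simp)
  have dη := (hη.contDiffAt hUp).differentiableAt (by simp)
  have h₁ := hηnull (1, 0)
  have h₂ := hηnull (0, 1)
  simp only [gform, mul_one, mul_zero, add_zero, zero_add] at h₁ h₂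
  have hab : (η p).1 ≠ 0 ∨ (η p).2 ≠ 0 := by
    by_contra! h
    exact hηp (Prod.ext h.1 h.2)
  obtain ⟨k, he, hf, hg⟩ := exists_coeff_eq_of_null hab h₁ h₂
  rw [fderiv_gform_self_of_null dE dF dG dη hηnull]
  rw [(hasFDerivAt_discriminant dE dF dG).fderiv] at hdlam ⊢
  have hk : k ≠ 0 := by
    rintro rfl
    exact hdlam (by simp [he, hf, hg])
  rw [← mul_ne_zero_iff_left hk (b := _ + _ + _)]
  refine not_congr (Eq.congr ?_ rfl)
  simp [he, hf, hg]
  ring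
end
end

section
/- Let φ = (u, v) be a smooth map from a neighborhood of (0,0) ∈ ℝ² (with coordinates (x, y)) to ℝ² with φ(0,0) = (0,0), invertible Jacobian at (0,0), and u_y(0,0) = 0. Let E, F, G be smooth near (0,0) with F(0,0) = G(0,0) = 0, E(0,0) > 0 and G_v(0,0) ≠ 0, and define Ê := (E∘φ)u_x² + 2(F∘φ)u_x v_x + (G∘φ)v_x², F̂ := (E∘φ)u_x u_y + (F∘φ)(u_x v_y + u_y v_x) + (G∘φ)v_x v_y, Ĝ := (E∘φ)u_y² + 2(F∘φ)u_y v_y + (G∘φ)v_y² (the pullback metric coefficients). Then Ĝ_y(0,0) ≠ 0 and (1/(Ê ∛Ĝ_y))·(F̂_x − Ê_y/2 − Ĝ_x²/(2Ĝ_y)) evaluated at (x,y) = (0,0) equals (1/(E ∛G_v))·(F_u − E_v/2 − G_u²/(2G_v)) evaluated at (u,v) = (0,0), where ∛ denotes the real cube root. -/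
noncomputable section

/-- Partial derivative in the first coordinate direction. -/
def pu {E : Type*} [NormedAddCommGroup E] [NormedSpace ℝ E]
    (f : ℝ × ℝ → E) (q : ℝ × ℝ) : E :=
  fderiv ℝ f q (1, 0)

/-- Partial derivative in the second coordinate direction. -/
def pv {E : Type*} [NormedAddCommGroup E] [NormedSpace ℝ E]
    (f : ℝ × ℝ → E) (q : ℝ × ℝ) : E :=
  fderiv ℝ f q (0, 1)

/-- The real cube root. -/
def cbrt (t : ℝ) : ℝ := if t < 0 then -((-t) ^ ((1 : ℝ) / 3)) else t ^ ((1 : ℝ) / 3)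

theorem cbrt_pow_three (t : ℝ) : cbrt t ^ 3 = t := by
  have key : ∀ s : ℝ, 0 ≤ s → (s ^ ((1 : ℝ) / 3)) ^ 3 = s := fun s hs => by
    rw [← Real.rpow_natCast, ← Real.rpow_mul hs]; norm_num
  unfold cbrt
  split_ifs with h
  · rw [Odd.neg_pow (by decide), key _ (by linarith), neg_neg]
  · exact key t (not_lt.mp h)

theorem cbrt_ne_zero {t : ℝ} (ht : t ≠ 0) : cbrt t ≠ 0 := fun h =>
  ht (by rw [← cbrt_pow_three t, h]; norm_num)

theorem cbrt_mul_pow_three (t c : ℝ) : cbrt (t * c ^ 3) = cbrt t * c := by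
  refine (Odd.strictMono_pow (R := ℝ) (n := 3) (by decide)).injective ?_
  simp only [mul_pow, cbrt_pow_three]

theorem hasFDerivAt_partial {f : ℝ × ℝ → ℝ} {p : ℝ × ℝ} (hf : ContDiffAt ℝ 2 f p)
    (w : ℝ × ℝ) :
    HasFDerivAt (fun q => fderiv ℝ f q w) ((fderiv ℝ (fderiv ℝ f) p).flip w) p := by
  have h : DifferentiableAt ℝ (fderiv ℝ f) p :=
    (hf.fderiv_right (m := 1) (by norm_num)).differentiableAt (by norm_num)
  exact (h.hasFDerivAt.clm_apply (hasFDerivAt_const w p)).congr_fderiv (by ext <;> simp)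

/-- Mixed second partial derivatives commute. -/
theorem pu_pv_comm {f : ℝ × ℝ → ℝ} {p : ℝ × ℝ} (hf : ContDiffAt ℝ 2 f p) :
    pu (pv f) p = pv (pu f) p := by
  have h1 : pu (pv f) p = _ := congrArg (· (1, 0)) (hasFDerivAt_partial hf (0, 1)).fderiv
  have h2 : pv (pu f) p = _ := congrArg (· (0, 1)) (hasFDerivAt_partial hf (1, 0)).fderiv
  rw [h1, h2]
  exact hf.isSymmSndFDerivAt (by simp) (1, 0) (0, 1)

/-- The chain rule, written with partial derivatives. -/
theorem fderiv_comp_eq_partials {f : ℝ × ℝ → ℝ} {φ : ℝ × ℝ → ℝ × ℝ} {p : ℝ × ℝ}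
    (hf : DifferentiableAt ℝ f (φ p)) (hφ : DifferentiableAt ℝ φ p) (w : ℝ × ℝ) :
    fderiv ℝ (fun q => f (φ q)) p w
      = pu f (φ p) * fderiv ℝ (fun q => (φ q).1) p w
        + pv f (φ p) * fderiv ℝ (fun q => (φ q).2) p w := by
  have h : fderiv ℝ (fun q => f (φ q)) p = _ := fderiv_comp p hf hφ
  rw [h, fderiv.fst hφ, fderiv.snd hφ]
  set z := fderiv ℝ φ p w with hz
  have hdec : z = z.1 • ((1 : ℝ), (0 : ℝ)) + z.2 • ((0 : ℝ), (1 : ℝ)) := by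
    ext <;> simp
  have : fderiv ℝ f (φ p) z = pu f (φ p) * z.1 + pv f (φ p) * z.2 := by
    conv_lhs => rw [hdec, map_add, map_smul, map_smul]
    simp only [pu, pv, smul_eq_mul]; ring
  simpa [hz] using this

/-- Leibniz rule for `A * X + B * Y + C * Z` at a point where `B` and `C` vanish. -/
theorem fderiv_metric_coeff {A B C X Y Z : ℝ × ℝ → ℝ} {p : ℝ × ℝ}
    (hA : DifferentiableAt ℝ A p) (hB : DifferentiableAt ℝ B p) (hC : DifferentiableAt ℝ C p)
    (hX : DifferentiableAt ℝ X p) (hY : DifferentiableAt ℝ Y p) (hZ : DifferentiableAt ℝ Z p)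
    (hB0 : B p = 0) (hC0 : C p = 0) (w : ℝ × ℝ) :
    fderiv ℝ (fun q => A q * X q + B q * Y q + C q * Z q) p w
      = fderiv ℝ A p w * X p + A p * fderiv ℝ X p w + fderiv ℝ B p w * Y p
        + fderiv ℝ C p w * Z p := by
  have h : fderiv ℝ (fun q => A q * X q + B q * Y q + C q * Z q) p = _ :=
    (((hA.hasFDerivAt.mul hX.hasFDerivAt).add (hB.hasFDerivAt.mul hY.hasFDerivAt)).add
      (hC.hasFDerivAt.mul hZ.hasFDerivAt)).fderiv
  rw [h]
  simp [hB0, hC0]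
  ring

theorem fderiv_mul_apply {X Y : ℝ × ℝ → ℝ} {p : ℝ × ℝ}
    (hX : DifferentiableAt ℝ X p) (hY : DifferentiableAt ℝ Y p) (w : ℝ × ℝ) :
    fderiv ℝ (X * Y) p w = fderiv ℝ X p w * Y p + X p * fderiv ℝ Y p w := by
  rw [(hX.hasFDerivAt.mul hY.hasFDerivAt).fderiv]
  simp
  ring

/-- The intrinsic lightlike singular curvature
`κ̃_L = (1/(E ∛G_v))·(F_u − E_v/2 − G_u²/(2G_v))` is independent of the choice of
adjusted coordinate system: under a coordinate change `φ = (u, v)` fixing the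
origin, with invertible Jacobian and `u_y(0,0) = 0`, the value computed from the
pullback coefficients `Ê, F̂, Ĝ` equals the value computed from `E, F, G`. -/
theorem intrinsic_lightlike_singular_curvature_well_defined
    (W : Set (ℝ × ℝ)) (hW : IsOpen W) (h0 : (0, 0) ∈ W)
    (φ : ℝ × ℝ → ℝ × ℝ) (hφ : ContDiffOn ℝ (⊤ : ℕ∞) φ W)
    (hmaps : Set.MapsTo φ W W) (hφ0 : φ (0, 0) = (0, 0))
    (uf vf : ℝ × ℝ → ℝ)
    (huf : uf = fun q => (φ q).1) (hvf : vf = fun q => (φ q).2)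
    (hJac : pu uf (0, 0) * pv vf (0, 0) - pv uf (0, 0) * pu vf (0, 0) ≠ 0)
    (huy : pv uf (0, 0) = 0)
    (E F G : ℝ × ℝ → ℝ)
    (hE : ContDiffOn ℝ (⊤ : ℕ∞) E W)
    (hF : ContDiffOn ℝ (⊤ : ℕ∞) F W)
    (hG : ContDiffOn ℝ (⊤ : ℕ∞) G W)
    (hF0 : F (0, 0) = 0) (hG0 : G (0, 0) = 0) (hE0 : 0 < E (0, 0))
    (hGv : pv G (0, 0) ≠ 0)
    (Ehat Fhat Ghat : ℝ × ℝ → ℝ)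
    (hEhat : Ehat = fun q =>
      E (φ q) * (pu uf q) ^ 2 + 2 * F (φ q) * (pu uf q * pu vf q)
        + G (φ q) * (pu vf q) ^ 2)
    (hFhat : Fhat = fun q =>
      E (φ q) * (pu uf q * pv uf q)
        + F (φ q) * (pu uf q * pv vf q + pv uf q * pu vf q)
        + G (φ q) * (pu vf q * pv vf q))
    (hGhat : Ghat = fun q =>
      E (φ q) * (pv uf q) ^ 2 + 2 * F (φ q) * (pv uf q * pv vf q)
        + G (φ q) * (pv vf q) ^ 2) :
    pv Ghat (0, 0) ≠ 0 ∧
    (1 / (Ehat (0, 0) * cbrt (pv Ghat (0, 0)))) *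
        (pu Fhat (0, 0) - pv Ehat (0, 0) / 2
          - (pu Ghat (0, 0)) ^ 2 / (2 * pv Ghat (0, 0)))
      = (1 / (E (0, 0) * cbrt (pv G (0, 0)))) *
        (pu F (0, 0) - pv E (0, 0) / 2
          - (pu G (0, 0)) ^ 2 / (2 * pv G (0, 0))) := by
  have hφp : ContDiffAt ℝ 2 φ (0, 0) :=
    contDiffAt_infty.mp (hφ.contDiffAt (hW.mem_nhds h0)) 2
  have hφd : DifferentiableAt ℝ φ (0, 0) := hφp.differentiableAt (by norm_num)
  have hdiff : ∀ f : ℝ × ℝ → ℝ, ContDiffOn ℝ (⊤ : ℕ∞) f W →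
      DifferentiableAt ℝ f (φ (0, 0)) := fun f hf => by
    rw [hφ0]
    exact (hf.contDiffAt (hW.mem_nhds h0)).differentiableAt (by simp)
  have hu : ContDiffAt ℝ 2 uf (0, 0) := huf ▸ hφp.fst
  have hv : ContDiffAt ℝ 2 vf (0, 0) := hvf ▸ hφp.snd
  have dux : DifferentiableAt ℝ (pu uf) (0, 0) :=
    (hasFDerivAt_partial hu (1, 0)).differentiableAt
  have duy : DifferentiableAt ℝ (pv uf) (0, 0) :=
    (hasFDerivAt_partial hu (0, 1)).differentiableAt
  have dvx : DifferentiableAt ℝ (pu vf) (0, 0) :=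
    (hasFDerivAt_partial hv (1, 0)).differentiableAt
  have dvy : DifferentiableAt ℝ (pv vf) (0, 0) :=
    (hasFDerivAt_partial hv (0, 1)).differentiableAt
  have dcomp : ∀ f : ℝ × ℝ → ℝ, ContDiffOn ℝ (⊤ : ℕ∞) f W →
      DifferentiableAt ℝ (fun q => f (φ q)) (0, 0) := fun f hf =>
    (hdiff f hf).comp (0, 0) hφd
  have chain : ∀ f : ℝ × ℝ → ℝ, ContDiffOn ℝ (⊤ : ℕ∞) f W → ∀ w,
      fderiv ℝ (fun q => f (φ q)) (0, 0) w
        = pu f (0, 0) * fderiv ℝ uf (0, 0) w + pv f (0, 0) * fderiv ℝ vf (0, 0) w :=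
    fun f hf w => by
      rw [fderiv_comp_eq_partials (hdiff f hf) hφd w, hφ0, huf, hvf]
  have leibniz : ∀ {X Y Z : ℝ × ℝ → ℝ}, DifferentiableAt ℝ X (0, 0) →
      DifferentiableAt ℝ Y (0, 0) → DifferentiableAt ℝ Z (0, 0) → ∀ w,
      fderiv ℝ (fun q => E (φ q) * X q + F (φ q) * Y q + G (φ q) * Z q) (0, 0) w
        = _ := fun hX hY hZ w =>
    fderiv_metric_coeff (dcomp E hE) (dcomp F hF) (dcomp G hG) hX hY hZ
      (by rw [hφ0, hF0]) (by rw [hφ0, hG0]) w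
  have hE' : Ehat = fun q => E (φ q) * (pu uf q * pu uf q)
      + F (φ q) * (2 * (pu uf q * pu vf q)) + G (φ q) * (pu vf q * pu vf q) := by
    rw [hEhat]; funext q; ring
  have hG' : Ghat = fun q => E (φ q) * (pv uf q * pv uf q)
      + F (φ q) * (2 * (pv uf q * pv vf q)) + G (φ q) * (pv vf q * pv vf q) := by
    rw [hGhat]; funext q; ring
  have eE : Ehat (0, 0) = E (0, 0) * pu uf (0, 0) ^ 2 := by
    simp [hEhat, hφ0, hF0, hG0]
  have eEy : pv Ehat (0, 0) = pv E (0, 0) * pv vf (0, 0) * pu uf (0, 0) ^ 2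
      + 2 * E (0, 0) * pu uf (0, 0) * pv (pu uf) (0, 0)
      + 2 * pv F (0, 0) * pv vf (0, 0) * pu uf (0, 0) * pu vf (0, 0)
      + pv G (0, 0) * pv vf (0, 0) * pu vf (0, 0) ^ 2 := by
    have h := leibniz (dux.mul dux) ((dux.mul dvx).const_mul 2) (dvx.mul dvx) (0, 1)
    simp only [Pi.mul_apply] at h
    rw [hE']
    change fderiv ℝ _ _ _ = _
    refine h.trans ?_
    rw [fderiv_mul_apply dux dux, chain E hE, chain F hF, chain G hG, hφ0]
    change (_ * pv uf (0, 0) + _ * pv vf (0, 0)) * _ + _ * (pv (pu uf) _ * _ + _ * pv (pu uf) _)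
      + (_ * pv uf (0, 0) + _ * pv vf (0, 0)) * _
      + (_ * pv uf (0, 0) + _ * pv vf (0, 0)) * _ = _
    rw [huy]
    ring
  have eFx : pu Fhat (0, 0) = E (0, 0) * pu uf (0, 0) * pv (pu uf) (0, 0)
      + (pu F (0, 0) * pu uf (0, 0) + pv F (0, 0) * pu vf (0, 0))
        * (pu uf (0, 0) * pv vf (0, 0))
      + (pu G (0, 0) * pu uf (0, 0) + pv G (0, 0) * pu vf (0, 0))
        * (pu vf (0, 0) * pv vf (0, 0)) := by
    have h := leibniz (dux.mul duy) ((dux.mul dvy).add (duy.mul dvx)) (dvx.mul dvy) (1, 0)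
    simp only [Pi.mul_apply, Pi.add_apply] at h
    rw [hFhat]
    change fderiv ℝ _ _ _ = _
    refine h.trans ?_
    rw [fderiv_mul_apply dux duy, chain E hE, chain F hF, chain G hG, hφ0]
    change (_ * pu uf (0, 0) + _ * pu vf (0, 0)) * _ + _ * (pu (pu uf) _ * _ + _ * pu (pv uf) _)
      + (_ * pu uf (0, 0) + _ * pu vf (0, 0)) * _
      + (_ * pu uf (0, 0) + _ * pu vf (0, 0)) * _ = _
    rw [huy, pu_pv_comm hu]
    ring
  have eG : ∀ w, fderiv ℝ Ghat (0, 0) w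
      = (pu G (0, 0) * fderiv ℝ uf (0, 0) w + pv G (0, 0) * fderiv ℝ vf (0, 0) w)
        * pv vf (0, 0) ^ 2 := fun w => by
    have h := leibniz (duy.mul duy) ((duy.mul dvy).const_mul 2) (dvy.mul dvy) w
    simp only [Pi.mul_apply] at h
    rw [hG']
    refine h.trans ?_
    rw [fderiv_mul_apply duy duy, chain G hG, huy]
    ring
  have eGx : pu Ghat (0, 0) = (pu G (0, 0) * pu uf (0, 0) + pv G (0, 0) * pu vf (0, 0))
      * pv vf (0, 0) ^ 2 := eG (1, 0)
  have eGy : pv Ghat (0, 0) = pv G (0, 0) * pv vf (0, 0) ^ 3 := by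
    have h : pv Ghat (0, 0) = (pu G (0, 0) * pv uf (0, 0) + pv G (0, 0) * pv vf (0, 0))
      * pv vf (0, 0) ^ 2 := eG (0, 1)
    rw [h, huy]; ring
  rw [huy, zero_mul, sub_zero] at hJac
  have ha := left_ne_zero_of_mul hJac
  have hc := right_ne_zero_of_mul hJac
  have hk := cbrt_ne_zero hGv
  have hE0' := hE0.ne'
  refine ⟨by rw [eGy]; exact mul_ne_zero hGv (pow_ne_zero 3 hc), ?_⟩
  rw [eE, eFx, eEy, eGx, eGy, cbrt_mul_pow_three]
  field_simp
  ring
end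
end

section
/- Let g = E du² + 2F du dv + G dv² be a metric on an open set U ⊆ ℝ² such that g_q is not negative definite for any q ∈ U, let λ := EG − F², and suppose every point of S(g) := {q ∈ U : λ(q) = 0} is admissible (dλ ≠ 0 there). Let p ∈ S(g) and let c : (−δ, δ) → U be a smooth regular curve with c(0) = p and c'(0) ∉ 𝒩ₚ (a non-null curve at p). Then there exist an open neighborhood V of (0,0) ∈ ℝ² and a smooth diffeomorphism φ : V → φ(V) ⊆ U with φ(0,0) = p such that, writing the pullback metric coefficients Ẽ(q) := g_{φ(q)}(φ_u, φ_u), F̃(q) := g_{φ(q)}(φ_u, φ_v), G̃(q) := g_{φ(q)}(φ_v, φ_v), one has: F̃ ≡ 0 on V (orthogonal coordinates); the image of c near p coincides with φ({(u,0) ∈ V}); and G̃(q) = 0 for every q ∈ V with λ(φ(q)) = 0 (∂_v is a null vector field along the semidefinite set). -/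
noncomputable section

section SmoothFlow

open Set Filter Topology Metric
open scoped ContDiff

section ParametricIntegral

universe w

variable {H : Type w} [NormedAddCommGroup H] [NormedSpace ℝ H] [FiniteDimensional ℝ H]

/-- Differentiation under the integral sign for a `C¹` integrand. -/
theorem hasFDerivAt_intervalIntegral_of_contDiff {X : Type*} [NormedAddCommGroup X]
    [NormedSpace ℝ X] {f : H × ℝ → X} (hf : ContDiff ℝ 1 f) (a b : ℝ) (x₀ : H) :
    HasFDerivAt (fun x => ∫ s in a..b, f (x, s))
      (∫ s in a..b, (fderiv ℝ f (x₀, s)).comp (ContinuousLinearMap.inl ℝ H ℝ)) x₀ := by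
  have : ProperSpace H := FiniteDimensional.proper ℝ H
  have hcont : Continuous fun q : H × ℝ =>
      (fderiv ℝ f q).comp (ContinuousLinearMap.inl ℝ H ℝ) :=
    (hf.continuous_fderiv one_ne_zero).clm_comp continuous_const
  obtain ⟨M, hM⟩ := ((isCompact_closedBall x₀ 1).prod
    (isCompact_uIcc (a := a) (b := b))).exists_bound_of_continuousOn hcont.continuousOn
  refine intervalIntegral.hasFDerivAt_integral_of_dominated_of_fderiv_le (bound := fun _ => M)
    (F' := fun x s => (fderiv ℝ f (x, s)).comp (ContinuousLinearMap.inl ℝ H ℝ))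
    (closedBall_mem_nhds x₀ one_pos) ?_ ?_ ?_ ?_ ?_ ?_
  · exact Eventually.of_forall fun x =>
      (hf.continuous.comp (by fun_prop : Continuous fun s : ℝ => (x, s))).aestronglyMeasurable
  · exact (hf.continuous.comp
      (by fun_prop : Continuous fun s : ℝ => (x₀, s))).intervalIntegrable _ _
  · exact (hcont.comp (by fun_prop : Continuous fun s : ℝ => (x₀, s))).aestronglyMeasurable
  · exact Eventually.of_forall fun s hs x hx => hM (x, s) ⟨hx, uIoc_subset_uIcc hs⟩
  · exact intervalIntegrable_const
  · refine Eventually.of_forall fun s _ x _ => ?_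
    exact ((hf.differentiable one_ne_zero) (x, s)).hasFDerivAt.comp x
      (hasFDerivAt_prodMk_left x s)

/-- An integral over a fixed interval depends on parameters as smoothly as its integrand. -/
theorem contDiff_intervalIntegral_param (n : ℕ) {X : Type w} [NormedAddCommGroup X]
    [NormedSpace ℝ X] {f : H × ℝ → X} (hf : ContDiff ℝ n f) (a b : ℝ) :
    ContDiff ℝ n (fun x => ∫ s in a..b, f (x, s)) := by
  induction n generalizing X with
  | zero =>
    have hf' : Continuous f := hf.continuous
    refine contDiff_zero.2 ?_
    exact intervalIntegral.continuous_parametric_intervalIntegral_of_continuous'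
      (f := fun x s => f (x, s)) hf' a b
  | succ n ih =>
    rw [Nat.cast_succ, contDiff_succ_iff_hasFDerivAt]
    refine ⟨_, ?_, fun x => hasFDerivAt_intervalIntegral_of_contDiff (hf.of_le ?_) a b x⟩
    · refine ih (f := fun q => (fderiv ℝ f q).comp (ContinuousLinearMap.inl ℝ H ℝ)) ?_
      exact (hf.fderiv_right (by norm_cast)).clm_comp contDiff_const
    · norm_cast
      omega

end ParametricIntegral

/-- A solution of the linear equation `d' = a d` is an exponential. -/
theorem eq_mul_exp_of_hasDerivAt {a d : ℝ → ℝ} (ha : Continuous a)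
    (hd : ∀ t, HasDerivAt d (a t * d t) t) (t : ℝ) :
    d t = d 0 * Real.exp (∫ s in (0 : ℝ)..t, a s) := by
  have hA : ∀ t, HasDerivAt (fun t => ∫ s in (0 : ℝ)..t, a s) (a t) t := fun t =>
    (ha.integral_hasStrictDerivAt 0 t).hasDerivAt
  have key : ∀ t, HasDerivAt (fun t => d t * Real.exp (-∫ s in (0 : ℝ)..t, a s)) 0 t := by
    intro t
    refine ((hd t).mul (hA t).neg.exp).congr_deriv ?_
    ring
  have := is_const_of_deriv_eq_zero (fun t => (key t).differentiableAt)
    (fun t => (key t).deriv) t 0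
  simp only [intervalIntegral.integral_same, neg_zero, Real.exp_zero, mul_one] at this
  rw [← this, mul_assoc, ← Real.exp_add]
  simp

/-- The averaged partial derivative appearing in Hadamard's lemma. -/
def meanPu (k : ℝ × ℝ → ℝ) (x y t : ℝ) : ℝ :=
  ∫ r in (0 : ℝ)..1, pu k (y + r * (x - y), t)

section Hadamard

variable {k : ℝ × ℝ → ℝ}

theorem continuous_pu (hk : ContDiff ℝ 1 k) : Continuous (pu k) :=
  (hk.continuous_fderiv one_ne_zero).clm_apply continuous_const

theorem sub_eq_meanPu_mul (hk : ContDiff ℝ 1 k) (x y t : ℝ) :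
    k (x, t) - k (y, t) = meanPu k x y t * (x - y) := by
  have hder : ∀ r : ℝ, HasDerivAt (fun r => k (y + r * (x - y), t))
      (pu k (y + r * (x - y), t) * (x - y)) r := by
    intro r
    have h1 : HasDerivAt (fun r : ℝ => ((y + r * (x - y), t) : ℝ × ℝ)) ((x - y) • (1, 0)) r := by
      have := ((((hasDerivAt_id r).mul_const (x - y)).const_add y).prodMk (hasDerivAt_const r t))
      simpa using this
    have h2 := ((hk.differentiable one_ne_zero) (y + r * (x - y), t)).hasFDerivAt.comp_hasDerivAt
      r h1
    refine h2.congr_deriv ?_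
    rw [map_smul, smul_eq_mul, mul_comm]
    rfl
  have hint := intervalIntegral.integral_eq_sub_of_hasDerivAt (a := 0) (b := 1)
    (fun r _ => hder r) (by
      apply Continuous.intervalIntegrable
      exact ((continuous_pu hk).comp (by fun_prop)).mul continuous_const)
  rw [intervalIntegral.integral_mul_const] at hint
  simp only [one_mul, add_sub_cancel, zero_mul, add_zero] at hint
  exact hint.symm

theorem continuous_meanPu (hk : ContDiff ℝ 1 k) :
    Continuous fun q : ℝ × ℝ × ℝ => meanPu k q.1 q.2.1 q.2.2 := by
  unfold meanPu
  refine intervalIntegral.continuous_parametric_intervalIntegral_of_continuous'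
    (f := fun (q : ℝ × ℝ × ℝ) r => pu k (q.2.1 + r * (q.1 - q.2.1), q.2.2)) ?_ 0 1
  exact (continuous_pu hk).comp (by fun_prop)

theorem meanPu_self (x t : ℝ) : meanPu k x x t = pu k (x, t) := by
  simp [meanPu]

theorem abs_meanPu_le {M : ℝ} (hM : ∀ q, |pu k q| ≤ M) (x y t : ℝ) : |meanPu k x y t| ≤ M := by
  have := intervalIntegral.norm_integral_le_of_norm_le_const (a := 0) (b := 1)
    (f := fun r => pu k (y + r * (x - y), t)) (C := M) (fun r _ => hM _)
  simpa [meanPu] using this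

end Hadamard

section Flow

variable {k : ℝ × ℝ → ℝ} {M : ℝ} {y : ℝ → ℝ → ℝ}

theorem flow_sub_flow (hk : ContDiff ℝ 1 k)
    (hy0 : ∀ u, y u 0 = u) (hy : ∀ u v, HasDerivAt (y u) (k (y u v, v)) v) (u₁ u₂ v : ℝ) :
    y u₁ v - y u₂ v =
      (u₁ - u₂) * Real.exp (∫ s in (0 : ℝ)..v, meanPu k (y u₁ s) (y u₂ s) s) := by
  have hyc : ∀ u, Continuous (y u) := fun u =>
    continuous_iff_continuousAt.2 fun v => (hy u v).continuousAt
  have := eq_mul_exp_of_hasDerivAt (a := fun s => meanPu k (y u₁ s) (y u₂ s) s)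
    (d := fun v => y u₁ v - y u₂ v)
    ((continuous_meanPu hk).comp
      ((hyc u₁).prodMk ((hyc u₂).prodMk continuous_id)))
    (fun t => ((hy u₁ t).sub (hy u₂ t)).congr_deriv (sub_eq_meanPu_mul hk _ _ _)) v
  simpa only [hy0] using this

theorem continuous_flow (hk : ContDiff ℝ 1 k) (hM : ∀ q, |pu k q| ≤ M)
    (hy0 : ∀ u, y u 0 = u) (hy : ∀ u v, HasDerivAt (y u) (k (y u v, v)) v) :
    Continuous fun q : ℝ × ℝ => y q.1 q.2 := by
  rw [continuous_iff_continuousAt]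
  rintro ⟨u₀, v₀⟩
  have hlip : ∀ u v, |y u v - y u₀ v| ≤ |u - u₀| * Real.exp (M * |v|) := by
    intro u v
    rw [flow_sub_flow hk hy0 hy, abs_mul, Real.abs_exp]
    gcongr
    refine (le_abs_self _).trans ?_
    have := intervalIntegral.norm_integral_le_of_norm_le_const (a := 0) (b := v)
      (f := fun s => meanPu k (y u s) (y u₀ s) s) (C := M) (fun s _ => abs_meanPu_le hM _ _ _)
    simpa using this
  have h1 : Tendsto (fun q : ℝ × ℝ => y q.1 q.2 - y u₀ q.2) (𝓝 (u₀, v₀)) (𝓝 0) := by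
    refine squeeze_zero_norm (fun q => hlip q.1 q.2) ?_
    have : Continuous fun q : ℝ × ℝ => |q.1 - u₀| * Real.exp (M * |q.2|) := by fun_prop
    simpa using this.tendsto (u₀, v₀)
  have h2 : Tendsto (fun q : ℝ × ℝ => y u₀ q.2) (𝓝 (u₀, v₀)) (𝓝 (y u₀ v₀)) :=
    (hy u₀ v₀).continuousAt.tendsto.comp continuous_snd.continuousAt
  simpa [ContinuousAt] using h1.add h2

/-- The derivative of the solution with respect to its initial value. -/
theorem hasDerivAt_flow_initial (hk : ContDiff ℝ 1 k) (hM : ∀ q, |pu k q| ≤ M)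
    (hy0 : ∀ u, y u 0 = u) (hy : ∀ u v, HasDerivAt (y u) (k (y u v, v)) v) (u₀ v : ℝ) :
    HasDerivAt (fun u => y u v) (Real.exp (∫ s in (0 : ℝ)..v, pu k (y u₀ s, s))) u₀ := by
  have hyc := continuous_flow hk hM hy0 hy
  have hA : Continuous fun u =>
      Real.exp (∫ s in (0 : ℝ)..v, meanPu k (y u s) (y u₀ s) s) := by
    refine Real.continuous_exp.comp ?_
    refine intervalIntegral.continuous_parametric_intervalIntegral_of_continuous'
      (f := fun u s => meanPu k (y u s) (y u₀ s) s) ?_ 0 v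
    refine (continuous_meanPu hk).comp (f := fun q : ℝ × ℝ => (y q.1 q.2, y u₀ q.2, q.2)) ?_
    exact hyc.prodMk ((hyc.comp (by fun_prop : Continuous fun q : ℝ × ℝ => (u₀, q.2))).prodMk
      continuous_snd)
  rw [hasDerivAt_iff_tendsto_slope]
  have h0 := (hA.tendsto u₀).mono_left (nhdsWithin_le_nhds (s := {u₀}ᶜ))
  simp only [meanPu_self] at h0
  refine h0.congr' ?_
  filter_upwards [self_mem_nhdsWithin] with u hu
  have hne : u - u₀ ≠ 0 := sub_ne_zero.2 hu
  rw [slope_def_field, flow_sub_flow hk hy0 hy]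
  field_simp

theorem hasFDerivAt_flow (hk : ContDiff ℝ 1 k) (hM : ∀ q, |pu k q| ≤ M)
    (hy0 : ∀ u, y u 0 = u) (hy : ∀ u v, HasDerivAt (y u) (k (y u v, v)) v) (q : ℝ × ℝ) :
    HasFDerivAt (fun q : ℝ × ℝ => y q.1 q.2)
      (Real.exp (∫ s in (0 : ℝ)..q.2, pu k (y q.1 s, s)) • ContinuousLinearMap.fst ℝ ℝ ℝ +
        k (y q.1 q.2, q.2) • ContinuousLinearMap.snd ℝ ℝ ℝ) q := by
  have hyc := continuous_flow hk hM hy0 hy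
  have hE : Continuous fun q : ℝ × ℝ =>
      Real.exp (∫ s in (0 : ℝ)..q.2, pu k (y q.1 s, s)) := by
    refine Real.continuous_exp.comp ?_
    refine intervalIntegral.continuous_parametric_intervalIntegral_of_continuous
      (f := fun (q : ℝ × ℝ) s => pu k (y q.1 s, s)) ?_ continuous_snd
    exact (continuous_pu hk).comp
      ((hyc.comp (by fun_prop : Continuous fun p : (ℝ × ℝ) × ℝ => (p.1.1, p.2))).prodMk
        continuous_snd)
  have hK : Continuous fun q : ℝ × ℝ => k (y q.1 q.2, q.2) :=
    hk.continuous.comp (hyc.prodMk continuous_snd)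
  have := hasStrictFDerivAt_uncurry_coprod (𝕜 := ℝ) (u := q) (f := y)
    (f₁ := fun u v => ContinuousLinearMap.toSpanSingleton ℝ
      (Real.exp (∫ s in (0 : ℝ)..v, pu k (y u s, s))))
    (f₂ := fun u v => ContinuousLinearMap.toSpanSingleton ℝ (k (y u v, v)))
    (Eventually.of_forall fun p => (hasDerivAt_flow_initial hk hM hy0 hy p.1 p.2).hasFDerivAt)
    (Eventually.of_forall fun p => (hy p.1 p.2).hasFDerivAt)
    (((ContinuousLinearMap.toSpanSingletonCLE (𝕜 := ℝ) (E := ℝ)).continuous.comp hE).continuousAt)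
    (((ContinuousLinearMap.toSpanSingletonCLE (𝕜 := ℝ) (E := ℝ)).continuous.comp hK).continuousAt)
  refine this.hasFDerivAt.congr_fderiv ?_
  ext <;> simp [Function.HasUncurry.uncurry]

/-- Solutions of a scalar equation with smooth right-hand side depend smoothly on time and
initial value. -/
theorem contDiff_flow (hk : ContDiff ℝ ∞ k) (hM : ∀ q, |pu k q| ≤ M)
    (hy0 : ∀ u, y u 0 = u) (hy : ∀ u v, HasDerivAt (y u) (k (y u v, v)) v) :
    ContDiff ℝ ∞ fun q : ℝ × ℝ => y q.1 q.2 := by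
  have hk1 : ContDiff ℝ 1 k := hk.of_le (by norm_cast)
  have hpu : ContDiff ℝ ∞ (pu k) :=
    (hk.fderiv_right (m := ∞) (by simp)).clm_apply contDiff_const
  rw [contDiff_infty]
  intro n
  induction n with
  | zero => exact contDiff_zero.2 (continuous_flow hk1 hM hy0 hy)
  | succ n ih =>
    rw [Nat.cast_succ, contDiff_succ_iff_hasFDerivAt]
    refine ⟨_, ?_, hasFDerivAt_flow hk1 hM hy0 hy⟩
    have hkn : ContDiff ℝ n k := contDiff_infty.1 hk n
    have hpun : ContDiff ℝ n (pu k) := contDiff_infty.1 hpu n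
    have hI : ContDiff ℝ n fun q : ℝ × ℝ => ∫ s in (0 : ℝ)..q.2, pu k (y q.1 s, s) := by
      have hrescale : (fun q : ℝ × ℝ => ∫ s in (0 : ℝ)..q.2, pu k (y q.1 s, s)) =
          fun q => q.2 * ∫ r in (0 : ℝ)..1, pu k (y q.1 (q.2 * r), q.2 * r) := by
        funext q
        have := intervalIntegral.mul_integral_comp_mul_left (a := 0) (b := 1)
          (f := fun s => pu k (y q.1 s, s)) (c := q.2)
        simpa using this.symm
      rw [hrescale]
      refine contDiff_snd.mul (contDiff_intervalIntegral_param n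
        (f := fun p : (ℝ × ℝ) × ℝ => pu k (y p.1.1 (p.1.2 * p.2), p.1.2 * p.2)) ?_ 0 1)
      refine hpun.comp (ContDiff.prodMk (ih.comp (f := fun p : (ℝ × ℝ) × ℝ =>
        (p.1.1, p.1.2 * p.2)) ?_) ?_) <;> fun_prop
    exact ((Real.contDiff_exp.comp hI).smul contDiff_const).add
      ((hkn.comp (ih.prodMk contDiff_snd)).smul contDiff_const)

end Flow

/-- A compactly supported smooth scalar equation, in the time parameter `sin v`, has a globally
defined smooth family of solutions. -/
theorem exists_contDiff_flow_sin {h : ℝ × ℝ → ℝ} (hh : ContDiff ℝ ∞ h)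
    (hsupp : HasCompactSupport h) :
    ∃ y : ℝ × ℝ → ℝ, ContDiff ℝ ∞ y ∧ (∀ u, y (u, 0) = u) ∧
      ∀ q, ∃ A : ℝ, 0 < A ∧ HasFDerivAt y (A • ContinuousLinearMap.fst ℝ ℝ ℝ +
        (Real.cos q.2 * h (y q, Real.sin q.2)) • ContinuousLinearMap.snd ℝ ℝ ℝ) q := by
  obtain ⟨K, hK⟩ := hh.lipschitzWith_of_hasCompactSupport hsupp (by simp)
  obtain ⟨L, hL⟩ := hh.continuous.bounded_above_of_compact_support hsupp
  have hL0 : 0 ≤ L := (norm_nonneg _).trans (hL 0)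
  have hex : ∀ u : ℝ, ∃ x : ℝ → ℝ, x 0 = u ∧
      ∀ t ∈ Ioo (-2 : ℝ) 2, HasDerivAt x (h (x t, t)) t := by
    intro u
    have hPL : IsPicardLindelof (fun t x => h (x, t)) (tmin := -2) (tmax := 2)
        ⟨0, by norm_num, by norm_num⟩ u (L.toNNReal * 2) 0 L.toNNReal K := by
      refine ⟨fun t _ => ?_, fun x _ => ?_, fun t _ x _ => ?_, ?_⟩
      · refine LipschitzWith.lipschitzOnWith ?_
        simpa [Function.comp_def] using hK.comp (LipschitzWith.prodMk_right t)
      · exact (hh.continuous.comp (by fun_prop)).continuousOn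
      · simpa [hL0] using hL (x, t)
      · simp
    obtain ⟨x, hx0, hx⟩ := hPL.exists_eq_forall_mem_Icc_hasDerivWithinAt₀
    exact ⟨x, hx0, fun t ht => (hx t (Ioo_subset_Icc_self ht)).hasDerivAt
      (Icc_mem_nhds ht.1 ht.2)⟩
  choose x hx0 hx using hex
  let k : ℝ × ℝ → ℝ := fun q => Real.cos q.2 * h (q.1, Real.sin q.2)
  have hk : ContDiff ℝ ∞ k :=
    (Real.contDiff_cos.comp contDiff_snd).mul
      (hh.comp (contDiff_fst.prodMk (Real.contDiff_sin.comp contDiff_snd)))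
  have hM : ∀ q, |pu k q| ≤ K := by
    intro q
    have hd : HasDerivAt (fun s => k (s, q.2)) (pu k q) q.1 :=
      ((hk.differentiable (by simp)) q).hasFDerivAt.comp_hasDerivAt (f := fun s => (s, q.2)) q.1
        ((hasDerivAt_id q.1).prodMk (hasDerivAt_const q.1 q.2))
    refine hd.le_of_lipschitz (C := K) (LipschitzWith.of_dist_le_mul fun a b => ?_)
    have := hK.dist_le_mul (a, Real.sin q.2) (b, Real.sin q.2)
    rw [dist_prod_same_right] at this
    simp only [k, Real.dist_eq, ← mul_sub, abs_mul] at this ⊢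
    exact (mul_le_of_le_one_left (abs_nonneg _) (Real.abs_cos_le_one _)).trans this
  have hy0 : ∀ u, x u (Real.sin 0) = u := by simpa using hx0
  have hy : ∀ u v, HasDerivAt (fun v => x u (Real.sin v)) (k (x u (Real.sin v), v)) v := by
    intro u v
    have hmem : Real.sin v ∈ Ioo (-2 : ℝ) 2 :=
      ⟨by linarith [Real.neg_one_le_sin v], by linarith [Real.sin_le_one v]⟩
    refine ((hx u _ hmem).comp v (Real.hasDerivAt_sin v)).congr_deriv ?_
    simp only [k]
    ring
  have hk1 : ContDiff ℝ 1 k := hk.of_le (by norm_cast)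
  refine ⟨fun q => x q.1 (Real.sin q.2), ?_, hy0, fun q => ?_⟩
  · exact contDiff_flow (y := fun u v => x u (Real.sin v)) hk hM hy0 hy
  · refine ⟨Real.exp (∫ s in (0 : ℝ)..q.2, pu k (x q.1 (Real.sin s), s)), Real.exp_pos _, ?_⟩
    exact hasFDerivAt_flow (y := fun u v => x u (Real.sin v)) hk1 hM hy0 hy q

end SmoothFlow

section LocalCoordinates

open Set Filter Topology Metric
open scoped ContDiff

/-- A germ of a smooth function extends to a compactly supported smooth function. -/
theorem exists_contDiff_hasCompactSupport_eventuallyEq {H : Type*} [NormedAddCommGroup H]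
    [NormedSpace ℝ H] [FiniteDimensional ℝ H] {f : H → ℝ} {x : H}
    (hf : ∀ᶠ z in 𝓝 x, ContDiffAt ℝ ∞ f z) :
    ∃ g : H → ℝ, ContDiff ℝ ∞ g ∧ HasCompactSupport g ∧ g =ᶠ[𝓝 x] f := by
  obtain ⟨r, hr, hball⟩ := nhds_basis_closedBall.mem_iff.1 hf
  let b : ContDiffBump x := ⟨r / 2, r, half_pos hr, half_lt_self hr⟩
  refine ⟨fun z => b z * f z, ?_, b.hasCompactSupport.mul_right, ?_⟩
  · rw [contDiff_iff_contDiffAt]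
    intro z
    by_cases hz : z ∈ tsupport b
    · rw [b.tsupport_eq] at hz
      exact b.contDiffAt.mul (hball hz)
    · refine (contDiffAt_const (c := (0 : ℝ))).congr_of_eventuallyEq ?_
      filter_upwards [notMem_tsupport_iff_eventuallyEq.1 hz] with w hw
      simp [hw]
  · filter_upwards [b.eventuallyEq_one] with z hz
    simp [hz]

theorem exists_isOpen_injOn_of_linearIndependent {f : ℝ × ℝ → ℝ × ℝ} {q : ℝ × ℝ}
    (hf : ContDiffAt ℝ ∞ f q) (hli : LinearIndependent ℝ ![pu f q, pv f q]) :
    ∃ V, IsOpen V ∧ q ∈ V ∧ InjOn f V := by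
  have hinj : Function.Injective (fderiv ℝ f q : ℝ × ℝ →ₗ[ℝ] ℝ × ℝ) := by
    refine (injective_iff_map_eq_zero _).2 fun z hz => ?_
    have hsum : z.1 • pu f q + z.2 • pv f q = 0 := by
      rw [← hz]
      simp only [pu, pv, ← map_smul, ← map_add, ContinuousLinearMap.coe_coe]
      congr 1
      ext <;> simp
    obtain ⟨h1, h2⟩ := LinearIndependent.pair_iff.1 hli _ _ hsum
    exact Prod.ext h1 h2
  let e := (LinearEquiv.ofInjectiveEndo _ hinj).toContinuousLinearEquiv
  have he : HasFDerivAt f (e : ℝ × ℝ →L[ℝ] ℝ × ℝ) q :=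
    (hf.differentiableAt (by simp)).hasFDerivAt.congr_fderiv (by ext <;> rfl)
  have hn : (∞ : WithTop ℕ∞) ≠ 0 := by simp
  exact ⟨_, (hf.toOpenPartialHomeomorph f he hn).open_source,
    hf.mem_toOpenPartialHomeomorph_source he hn, (hf.toOpenPartialHomeomorph f he hn).injOn⟩

theorem linearIndependent_pair_of_det_ne_zero {x z : ℝ × ℝ} (h : x.1 * z.2 - x.2 * z.1 ≠ 0) :
    LinearIndependent ℝ ![x, z] := by
  rw [LinearIndependent.pair_iff]
  intro s t hst
  have h1 : s * x.1 + t * z.1 = 0 := by simpa using congrArg Prod.fst hst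
  have h2 : s * x.2 + t * z.2 = 0 := by simpa using congrArg Prod.snd hst
  constructor
  · refine (mul_eq_zero.1 ?_).resolve_right h
    linear_combination z.2 * h1 - z.1 * h2
  · refine (mul_eq_zero.1 ?_).resolve_right h
    linear_combination x.1 * h2 - x.2 * h1

section GramIdentities

variable (E F G : ℝ × ℝ → ℝ) (q : ℝ × ℝ)

theorem gform_gram_det (x z : ℝ × ℝ) :
    gform E F G q x x * gform E F G q z z - gform E F G q x z * gform E F G q x z =
      (E q * G q - F q * F q) * (x.1 * z.2 - x.2 * z.1) ^ 2 := by
  unfold gform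
  ring

/-- The slope `h` for which `h x + z` is orthogonal to the non-null vector `x`. -/
def orthSlope (x z : ℝ × ℝ) : ℝ :=
  -gform E F G q x z / gform E F G q x x

variable {E F G q} {x z : ℝ × ℝ}

theorem gform_self_ne_zero_of_det_eq_zero (hdet : E q * G q - F q * F q = 0)
    (h : gform E F G q x z ≠ 0) : gform E F G q x x ≠ 0 := by
  intro h0
  have := gform_gram_det E F G q x z
  rw [hdet, h0] at this
  exact h (mul_self_eq_zero.1 (by linarith))

theorem gform_orthSlope_eq_zero (hx : gform E F G q x x ≠ 0) (A C : ℝ) :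
    gform E F G q (A • x) ((C * orthSlope E F G q x z) • x + C • z) = 0 := by
  have h : orthSlope E F G q x z * gform E F G q x x = -gform E F G q x z :=
    div_mul_cancel₀ _ hx
  unfold gform at h ⊢
  simp only [Prod.smul_fst, Prod.smul_snd, Prod.fst_add, Prod.snd_add, smul_eq_mul]
  linear_combination A * C * h

theorem gform_orthSlope_self_eq_zero (hx : gform E F G q x x ≠ 0)
    (hdet : E q * G q - F q * F q = 0) (C : ℝ) :
    gform E F G q ((C * orthSlope E F G q x z) • x + C • z)
      ((C * orthSlope E F G q x z) • x + C • z) = 0 := by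
  have h : orthSlope E F G q x z * gform E F G q x x = -gform E F G q x z :=
    div_mul_cancel₀ _ hx
  have hgram := gform_gram_det E F G q x z
  rw [hdet, zero_mul] at hgram
  refine (mul_eq_zero.1 ?_).resolve_left hx
  have hexp : gform E F G q ((C * orthSlope E F G q x z) • x + C • z)
      ((C * orthSlope E F G q x z) • x + C • z) =
      C ^ 2 * (orthSlope E F G q x z ^ 2 * gform E F G q x x +
        2 * orthSlope E F G q x z * gform E F G q x z + gform E F G q z z) := by
    generalize orthSlope E F G q x z = s
    unfold gform
    simp only [Prod.smul_fst, Prod.smul_snd, Prod.fst_add, Prod.snd_add, smul_eq_mul]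
    ring
  rw [hexp]
  linear_combination C ^ 2 * hgram +
    C ^ 2 * (orthSlope E F G q x z * gform E F G q x x + gform E F G q x z) * h

end GramIdentities

theorem ContDiffAt.gform {H : Type*} [NormedAddCommGroup H] [NormedSpace ℝ H]
    {E F G : ℝ × ℝ → ℝ} {f x z : H → ℝ × ℝ} {a : H} {n : WithTop ℕ∞}
    (hE : ContDiffAt ℝ n E (f a)) (hF : ContDiffAt ℝ n F (f a)) (hG : ContDiffAt ℝ n G (f a))
    (hf : ContDiffAt ℝ n f a) (hx : ContDiffAt ℝ n x a) (hz : ContDiffAt ℝ n z a) :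
    ContDiffAt ℝ n (fun b => gform E F G (f b) (x b) (z b)) a := by
  unfold _root_.gform
  have hE' := hE.comp a hf
  have hF' := hF.comp a hf
  have hG' := hG.comp a hf
  simp only [Function.comp_def] at hE' hF' hG'
  fun_prop

end LocalCoordinates

/-- Existence of orthogonal coordinates adapted to a non-null curve
through an admissible semidefinite point of a nowhere negative definite metric:
there is a diffeomorphism `φ` onto a neighborhood of `p` (smooth, injective,
with linearly independent partials) such that `F̃ ≡ 0`, the image of `c` near
`p` coincides with `φ` of the `u`-axis, and `∂_v` is null along the
semidefinite set. -/
theorem exists_orthogonal_coordinates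
    (U : Set (ℝ × ℝ)) (hU : IsOpen U)
    (E F G : ℝ × ℝ → ℝ)
    (hE : ContDiffOn ℝ (⊤ : ℕ∞) E U)
    (hF : ContDiffOn ℝ (⊤ : ℕ∞) F U)
    (hG : ContDiffOn ℝ (⊤ : ℕ∞) G U)
    (lam : ℝ × ℝ → ℝ) (hlamdef : lam = fun q => E q * G q - F q * F q)
    (hnotneg : ∀ q ∈ U, ¬ (∀ v : ℝ × ℝ, v ≠ 0 → gform E F G q v v < 0))
    (hadm : ∀ q ∈ U, lam q = 0 → fderiv ℝ lam q ≠ 0)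
    (p : ℝ × ℝ) (hp : p ∈ U) (hplam : lam p = 0)
    (δ : ℝ) (hδ : 0 < δ)
    (c : ℝ → ℝ × ℝ) (hc : ContDiffOn ℝ (⊤ : ℕ∞) c (Set.Ioo (-δ) δ))
    (hcU : ∀ t ∈ Set.Ioo (-δ) δ, c t ∈ U)
    (hc0 : c 0 = p)
    (hreg : ∀ t ∈ Set.Ioo (-δ) δ, deriv c t ≠ 0)
    (hnonnull : ∃ w : ℝ × ℝ, gform E F G p (deriv c 0) w ≠ 0) :
    ∃ (V : Set (ℝ × ℝ)) (φ : ℝ × ℝ → ℝ × ℝ),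
      IsOpen V ∧ (0, 0) ∈ V ∧
      ContDiffOn ℝ (⊤ : ℕ∞) φ V ∧
      φ (0, 0) = p ∧ (∀ q ∈ V, φ q ∈ U) ∧
      Set.InjOn φ V ∧
      (∀ q ∈ V, LinearIndependent ℝ ![pu φ q, pv φ q]) ∧
      -- orthogonal coordinates: F̃ ≡ 0 on V
      (∀ q ∈ V, gform E F G (φ q) (pu φ q) (pv φ q) = 0) ∧
      -- the image of c coincides with the u-axis near p
      (∃ ε > 0, ε ≤ δ ∧
        (∀ t ∈ Set.Ioo (-ε) ε, c t ∈ φ '' {q ∈ V | q.2 = 0}) ∧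
        (∀ q ∈ V, q.2 = 0 → φ q ∈ c '' Set.Ioo (-δ) δ)) ∧
      -- ∂_v is a null vector field along the semidefinite set
      (∀ q ∈ V, lam (φ q) = 0 →
        gform E F G (φ q) (pv φ q) (pv φ q) = 0) := by
  set x₀ : ℝ × ℝ := deriv c 0
  set n : ℝ × ℝ := (-x₀.2, x₀.1) with hn
  have h0mem : (0 : ℝ) ∈ Set.Ioo (-δ) δ := ⟨by linarith, hδ⟩
  have hdet0 : x₀.1 * n.2 - x₀.2 * n.1 ≠ 0 := by
    intro h
    have hsq : x₀.1 * x₀.1 + x₀.2 * x₀.2 = 0 := by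
      rw [← h]
      simp only [hn]
      ring
    refine hreg 0 h0mem (Prod.ext ?_ ?_)
    · exact mul_self_eq_zero.1 (by nlinarith [mul_self_nonneg x₀.1, mul_self_nonneg x₀.2])
    · exact mul_self_eq_zero.1 (by nlinarith [mul_self_nonneg x₀.1, mul_self_nonneg x₀.2])
  have hc' : ∀ t ∈ Set.Ioo (-δ) δ, ContDiffAt ℝ (⊤ : ℕ∞) c t := fun t ht =>
    hc.contDiffAt (isOpen_Ioo.mem_nhds ht)
  have hdc : ∀ t ∈ Set.Ioo (-δ) δ, ContDiffAt ℝ (⊤ : ℕ∞) (deriv c) t := fun t ht =>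
    (hc.deriv_of_isOpen isOpen_Ioo (by simp)).contDiffAt (isOpen_Ioo.mem_nhds ht)
  let Ψ : ℝ × ℝ → ℝ × ℝ := fun z => c z.1 + z.2 • n
  let x : ℝ × ℝ → ℝ × ℝ := fun z => deriv c z.1
  have hΨ0 : Ψ (0, 0) = p := by simp [Ψ, hc0]
  have hΨ : ∀ z : ℝ × ℝ, z.1 ∈ Set.Ioo (-δ) δ → ContDiffAt ℝ (⊤ : ℕ∞) Ψ z := fun z hz =>
    ((hc' _ hz).comp z contDiffAt_fst).add (contDiffAt_snd.smul contDiffAt_const)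
  have hx : ∀ z : ℝ × ℝ, z.1 ∈ Set.Ioo (-δ) δ → ContDiffAt ℝ (⊤ : ℕ∞) x z := fun z hz =>
    (hdc _ hz).comp z contDiffAt_fst
  have hg : ∀ z : ℝ × ℝ, z.1 ∈ Set.Ioo (-δ) δ → Ψ z ∈ U → ∀ X Y : ℝ × ℝ → ℝ × ℝ,
      ContDiffAt ℝ (⊤ : ℕ∞) X z → ContDiffAt ℝ (⊤ : ℕ∞) Y z →
      ContDiffAt ℝ (⊤ : ℕ∞) (fun z => gform E F G (Ψ z) (X z) (Y z)) z := by
    intro z hz hzU X Y hX hY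
    exact ContDiffAt.gform (hE.contDiffAt (hU.mem_nhds hzU)) (hF.contDiffAt (hU.mem_nhds hzU))
      (hG.contDiffAt (hU.mem_nhds hzU)) (hΨ z hz) hX hY
  have hgx0 : gform E F G (Ψ (0, 0)) (x (0, 0)) (x (0, 0)) ≠ 0 := by
    obtain ⟨w, hw⟩ := hnonnull
    rw [hΨ0]
    refine gform_self_ne_zero_of_det_eq_zero ?_ hw
    rw [hlamdef] at hplam
    exact hplam
  have hW : ∀ᶠ z : ℝ × ℝ in nhds (0, 0), z.1 ∈ Set.Ioo (-δ) δ ∧ Ψ z ∈ U ∧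
      gform E F G (Ψ z) (x z) (x z) ≠ 0 ∧ (x z).1 * n.2 - (x z).2 * n.1 ≠ 0 := by
    refine Filter.Eventually.and ?_ (Filter.Eventually.and ?_ (Filter.Eventually.and ?_ ?_))
    · exact continuousAt_fst.eventually_mem (isOpen_Ioo.mem_nhds h0mem)
    · refine (hΨ _ h0mem).continuousAt.eventually_mem (hU.mem_nhds ?_)
      rwa [hΨ0]
    · exact (hg _ h0mem (by rwa [hΨ0]) x x (hx _ h0mem) (hx _ h0mem)).continuousAt.eventually_ne
        hgx0
    · have hxc : ContinuousAt x (0, 0) := (hx _ h0mem).continuousAt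
      refine ContinuousAt.eventually_ne (g := fun z => (x z).1 * n.2 - (x z).2 * n.1) ?_ hdet0
      fun_prop
  obtain ⟨h, hh, hhsupp, hheq⟩ := exists_contDiff_hasCompactSupport_eventuallyEq
    (f := fun z => orthSlope E F G (Ψ z) (x z) n) (x := ((0, 0) : ℝ × ℝ)) <| by
    filter_upwards [hW] with z ⟨hz, hzU, hgz, _⟩
    exact (hg z hz hzU x (fun _ => n) (hx z hz) contDiffAt_const).neg.div
      (hg z hz hzU x x (hx z hz) (hx z hz)) hgz
  obtain ⟨y, hy, hy0, hyder⟩ := exists_contDiff_flow_sin hh hhsupp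
  let Θ : ℝ × ℝ → ℝ × ℝ := fun q => (y q, Real.sin q.2)
  have hΘ : ContDiff ℝ (⊤ : ℕ∞) Θ := hy.prodMk (Real.contDiff_sin.comp contDiff_snd)
  have hΘ0 : Θ (0, 0) = (0, 0) := by simp [Θ, hy0]
  have hevent : ∀ᶠ q : ℝ × ℝ in nhds (0, 0), (((Θ q).1 ∈ Set.Ioo (-δ) δ ∧ Ψ (Θ q) ∈ U ∧
      gform E F G (Ψ (Θ q)) (x (Θ q)) (x (Θ q)) ≠ 0 ∧
      (x (Θ q)).1 * n.2 - (x (Θ q)).2 * n.1 ≠ 0) ∧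
      h (Θ q) = orthSlope E F G (Ψ (Θ q)) (x (Θ q)) n) ∧ Real.cos q.2 ≠ 0 := by
    have ht : Filter.Tendsto Θ (nhds (0, 0)) (nhds (0, 0)) := by
      simpa only [hΘ0] using hΘ.continuous.tendsto (0, 0)
    refine (ht.eventually (hW.and hheq)).and ?_
    refine ContinuousAt.eventually_ne (g := fun q : ℝ × ℝ => Real.cos q.2) ?_ (by simp)
    fun_prop
  obtain ⟨V₁, hV₁, hV₁open, h0V₁⟩ := eventually_nhds_iff.1 hevent
  let φ : ℝ × ℝ → ℝ × ℝ := fun q => Ψ (Θ q)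
  have hφ : ∀ q ∈ V₁, ContDiffAt ℝ (⊤ : ℕ∞) φ q := fun q hq =>
    (hΨ (Θ q) (hV₁ q hq).1.1.1).comp q hΘ.contDiffAt
  have hpartial : ∀ q ∈ V₁, ∃ A : ℝ, 0 < A ∧ pu φ q = A • x (Θ q) ∧
      pv φ q = (Real.cos q.2 * orthSlope E F G (Ψ (Θ q)) (x (Θ q)) n) • x (Θ q) +
        Real.cos q.2 • n := by
    intro q hq
    obtain ⟨⟨⟨hmem, -⟩, hhq⟩, -⟩ := hV₁ q hq
    obtain ⟨A, hA, hyq⟩ := hyder q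
    have hcq : HasDerivAt c (x (Θ q)) (y q) :=
      ((hc' (y q) hmem).differentiableAt (by simp)).hasDerivAt
    have hsin : HasFDerivAt (fun q : ℝ × ℝ => Real.sin q.2)
        (Real.cos q.2 • ContinuousLinearMap.snd ℝ ℝ ℝ) q :=
      (Real.hasDerivAt_sin q.2).comp_hasFDerivAt q hasFDerivAt_snd
    have hder := ((hcq.hasFDerivAt.comp q hyq).add (hsin.smul_const n)).fderiv
    have hφder : fderiv ℝ φ q = _ := hder
    refine ⟨A, hA, ?_, ?_⟩
    · rw [pu, hφder]
      simp
    · rw [pv, hφder, ← hhq]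
      simp [Θ]
  have hli : ∀ q ∈ V₁, LinearIndependent ℝ ![pu φ q, pv φ q] := by
    intro q hq
    obtain ⟨A, hA, hu, hv⟩ := hpartial q hq
    obtain ⟨⟨⟨-, -, -, hdet⟩, -⟩, hcos⟩ := hV₁ q hq
    rw [hu, hv]
    refine linearIndependent_pair_of_det_ne_zero ?_
    have hprod := mul_ne_zero (mul_ne_zero hA.ne' hcos) hdet
    convert! hprod using 1
    simp only [Prod.smul_fst, Prod.smul_snd, Prod.fst_add, Prod.snd_add, smul_eq_mul]
    ring
  obtain ⟨V₂, hV₂open, h0V₂, hinj⟩ :=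
    exists_isOpen_injOn_of_linearIndependent (hφ _ h0V₁) (hli _ h0V₁)
  have hVopen : IsOpen (V₁ ∩ V₂) := hV₁open.inter hV₂open
  have haxis : ∀ t, φ (t, 0) = c t := fun t => by simp [φ, Ψ, Θ, hy0]
  refine ⟨V₁ ∩ V₂, φ, hVopen, ⟨h0V₁, h0V₂⟩, fun q hq => (hφ q hq.1).contDiffWithinAt,
    by rw [haxis, hc0], fun q hq => (hV₁ q hq.1).1.1.2.1, hinj.mono Set.inter_subset_right,
    fun q hq => hli q hq.1, ?_, ?_, ?_⟩
  · intro q hq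
    obtain ⟨A, -, hu, hv⟩ := hpartial q hq.1
    rw [hu, hv]
    exact gform_orthSlope_eq_zero (hV₁ q hq.1).1.1.2.2.1 A _
  · have hnear : ∀ᶠ t : ℝ in nhds 0, (t, (0 : ℝ)) ∈ V₁ ∩ V₂ :=
      (by fun_prop : Continuous fun t : ℝ => (t, (0 : ℝ))).continuousAt.eventually_mem
        (hVopen.mem_nhds ⟨h0V₁, h0V₂⟩)
    obtain ⟨ε, hε, hεV⟩ := Metric.eventually_nhds_iff.1 hnear
    refine ⟨min ε δ, lt_min hε hδ, min_le_right _ _, fun t ht => ?_, ?_⟩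
    · refine ⟨(t, 0), ⟨hεV ?_, rfl⟩, haxis t⟩
      rw [Real.dist_eq, sub_zero]
      exact (abs_lt.2 ht).trans_le (min_le_left _ _)
    · rintro ⟨u, v⟩ hq rfl
      refine ⟨u, ?_, (haxis u).symm⟩
      simpa [Θ, hy0] using (hV₁ _ hq.1).1.1.1
  · intro q hq hlamq
    obtain ⟨A, -, -, hv⟩ := hpartial q hq.1
    rw [hv]
    rw [hlamdef] at hlamq
    exact gform_orthSlope_self_eq_zero (hV₁ q hq.1).1.1.2.2.1 hlamq _
end
end

section
/- Let g = E du² + 2F du dv + G dv² be a metric on an open set U ⊆ ℝ² such that g_q is not negative definite for any q ∈ U, and let p ∈ U satisfy λ(p) = 0 and dλ(p) ≠ 0, where λ := EG − F². Then g_p is positive semidefinite, i.e. the matrix ((E(p), F(p)), (F(p), G(p))) is positive semidefinite. -/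
noncomputable section

/-- A metric is negative definite at a point where `E < 0` and `λ > 0`. -/
theorem gform_neg_of_neg_of_discr_pos {E F G : ℝ × ℝ → ℝ} {q : ℝ × ℝ} (hE : E q < 0)
    (hlam : 0 < E q * G q - F q * F q) {v : ℝ × ℝ} (hv : v ≠ 0) : gform E F G q v v < 0 := by
  obtain ⟨a, b⟩ := v
  have hsq : E q * gform E F G q (a, b) (a, b)
      = (E q * a + F q * b) ^ 2 + (E q * G q - F q * F q) * b ^ 2 := by
    simp only [gform]; ring
  have hpos : 0 < E q * gform E F G q (a, b) (a, b) := by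
    rw [hsq]
    rcases eq_or_ne b 0 with rfl | hb
    · have ha : a ≠ 0 := by rintro rfl; exact hv rfl
      have := hE.ne
      simp only [mul_zero, add_zero, ne_eq, OfNat.ofNat_ne_zero, not_false_eq_true, zero_pow]
      positivity
    · exact add_pos_of_nonneg_of_pos (sq_nonneg _) (by positivity)
  by_contra! h
  exact hpos.not_ge (mul_nonpos_of_nonpos_of_nonneg hE.le h)

/-- A real symmetric `2 × 2` matrix with nonnegative diagonal and determinant is positive
semidefinite. -/
theorem posSemidef_fin_two_of_nonneg {a b c : ℝ} (ha : 0 ≤ a) (hc : 0 ≤ c)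
    (hdet : 0 ≤ a * c - b * b) : Matrix.PosSemidef !![a, b; b, c] := by
  refine Matrix.PosSemidef.of_dotProduct_mulVec_nonneg ?_ fun x => ?_
  · ext i j; fin_cases i <;> fin_cases j <;> rfl
  · simp only [Matrix.mulVec, dotProduct, Fin.sum_univ_two, Pi.star_apply, star_trivial,
      Matrix.of_apply, Matrix.cons_val', Matrix.cons_val_zero, Matrix.cons_val_one,
      Matrix.cons_val_fin_one]
    rcases ha.eq_or_lt with rfl | ha
    · obtain rfl : b = 0 := by nlinarith
      nlinarith [mul_nonneg hc (sq_nonneg (x 1))]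
    · refine nonneg_of_mul_nonneg_right (a := a) ?_ ha
      nlinarith [sq_nonneg (a * x 0 + b * x 1), mul_nonneg hdet (sq_nonneg (x 1))]

/-- If the metric `g = E du² + 2F du dv + G dv²` on an open set `U`
is nowhere negative definite and `p ∈ U` is an admissible semidefinite point
(`λ(p) = 0`, `dλ(p) ≠ 0` with `λ = EG − F²`), then `g_p` is positive
semidefinite. -/
theorem metric_posSemidef_at_admissible_point
    (U : Set (ℝ × ℝ)) (hU : IsOpen U)
    (E F G : ℝ × ℝ → ℝ)
    (hE : ContDiffOn ℝ (⊤ : ℕ∞) E U)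
    (hF : ContDiffOn ℝ (⊤ : ℕ∞) F U)
    (hG : ContDiffOn ℝ (⊤ : ℕ∞) G U)
    (hnotneg : ∀ q ∈ U, ¬ (∀ v : ℝ × ℝ, v ≠ 0 → gform E F G q v v < 0))
    (p : ℝ × ℝ) (hp : p ∈ U)
    (hlam0 : E p * G p - F p * F p = 0)
    (hdlam : fderiv ℝ (fun q => E q * G q - F q * F q) p ≠ 0) :
    Matrix.PosSemidef !![E p, F p; F p, G p] := by
  have hmax : ¬ IsLocalMax (fun q => E q * G q - F q * F q) p :=
    fun h => hdlam h.fderiv_eq_zero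
  have hfreq : ∃ᶠ q in nhds p, 0 < E q * G q - F q * F q := by
    simpa only [IsLocalMax, IsMaxFilter, hlam0, Filter.not_eventually, not_le] using hmax
  have hU' := hU.mem_nhds hp
  have not_neg : ¬ ∃ᶠ q in nhds p, 0 < E q * G q - F q * F q ∧ E q < 0 := by
    intro h
    obtain ⟨q, ⟨hq, hEq⟩, hqU⟩ := (h.and_eventually hU').exists
    exact hnotneg q hqU fun v hv => gform_neg_of_neg_of_discr_pos hEq hq hv
  have hEp : 0 ≤ E p := by
    by_contra! h
    exact not_neg (hfreq.and_eventually ((hE.continuousOn.continuousAt hU').eventually_lt_const h))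
  have hGp : 0 ≤ G p := by
    by_contra! h
    refine not_neg ((hfreq.and_eventually
      ((hG.continuousOn.continuousAt hU').eventually_lt_const h)).mono fun q hq => ⟨hq.1, ?_⟩)
    nlinarith [hq.1, hq.2, mul_self_nonneg (F q)]
  exact posSemidef_fin_two_of_nonneg hEp hGp hlam0.ge
end
end

section
/- Let g = E du² + 2F du dv + G dv² be a metric on an open set U ⊆ ℝ², nowhere negative definite, with λ := EG − F², and suppose every point of S(g) := {λ = 0} ∩ U is admissible (dλ ≠ 0 there). Let p ∈ S(g) and let c : (−δ, δ) → U be a smooth regular curve with c(0) = p and c'(0) ∉ 𝒩ₚ. Then there exist an open neighborhood V of (0,0) ∈ ℝ² and a smooth diffeomorphism φ : V → φ(V) ⊆ U with φ(0,0) = p such that the pullback coefficients Ẽ(q) := g_{φ(q)}(φ_u, φ_u), F̃(q) := g_{φ(q)}(φ_u, φ_v), G̃(q) := g_{φ(q)}(φ_v, φ_v) satisfy: F̃ ≡ 0 on V; the image of c near p coincides with φ({(u,0) ∈ V}); G̃(q) = 0 for every q ∈ V with λ(φ(q)) = 0; and Ẽ(u,0) = 1 for all u with (u,0) ∈ V (so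 u ↦ φ(u,0) parametrizes c by g-arclength). Such (V; u, v) is called an L-coordinate system associated with c. -/
noncomputable section

open Set Filter Topology Metric
open scoped ContDiff unitInterval

/-- Pointwise application of a continuous family of operators to a continuous map. -/
noncomputable def ContinuousMap.pointwiseApplyL (K : Type*) [TopologicalSpace K] [CompactSpace K]
    (A B : Type*) [NormedAddCommGroup A] [NormedSpace ℝ A] [NormedAddCommGroup B]
    [NormedSpace ℝ B] : C(K, A →L[ℝ] B) →L[ℝ] C(K, A) →L[ℝ] C(K, B) :=
  LinearMap.mkContinuous₂
    (LinearMap.mk₂ ℝ (fun (T : C(K, A →L[ℝ] B)) (h : C(K, A)) =>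
        (⟨fun s => T s (h s), by fun_prop⟩ : C(K, B)))
      (fun _ _ _ => by ext; simp) (fun _ _ _ => by ext; simp)
      (fun _ _ _ => by ext; simp) (fun _ _ _ => by ext; simp))
    1 (fun T h => by
      rw [ContinuousMap.norm_le _ (by positivity)]
      intro s
      rw [one_mul]
      exact (T s).le_of_opNorm_le_of_le (T.norm_coe_le_norm s) (h.norm_coe_le_norm s))

theorem ContinuousMap.hasFDerivAt_comp_left {K : Type*} [TopologicalSpace K] [CompactSpace K]
    {A B : Type*} [NormedAddCommGroup A] [NormedSpace ℝ A] [NormedAddCommGroup B]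
    [NormedSpace ℝ B] {f : A → B} (hf : ContDiff ℝ 1 f) (y : C(K, A)) :
    HasFDerivAt (fun y : C(K, A) => (⟨f, hf.continuous⟩ : C(A, B)).comp y)
      (pointwiseApplyL K A B
        ((⟨fderiv ℝ f, hf.continuous_fderiv one_ne_zero⟩ : C(A, A →L[ℝ] B)).comp y)) y := by
  rw [hasFDerivAt_iff_isLittleO, Asymptotics.isLittleO_iff]
  intro ε hε
  obtain ⟨r, hr, hball⟩ := (Metric.continuousAt_iff (α := C(K, A)) (β := C(K, A →L[ℝ] B))).1
    (continuous_postcomp ⟨fderiv ℝ f, hf.continuous_fderiv one_ne_zero⟩).continuousAt ε hε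
  filter_upwards [Metric.ball_mem_nhds y hr] with z hz
  rw [ContinuousMap.norm_le _ (by positivity)]
  intro s
  have hzs : z s ∈ ball (y s) r := lt_of_le_of_lt (ContinuousMap.dist_apply_le_dist s) hz
  have key := (convex_ball (y s) r).norm_image_sub_le_of_norm_fderiv_le' (𝕜 := ℝ) (f := f)
    (C := ε) (φ := fderiv ℝ f (y s)) (fun x _ => (hf.differentiable one_ne_zero) x)
    (fun x hx => ?_) (mem_ball_self hr) hzs
  · refine key.trans ?_
    gcongr
    exact (z - y).norm_coe_le_norm s
  · have h1 : dist (y + ContinuousMap.const K (x - y s)) y < r := by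
      refine lt_of_le_of_lt ?_ (mem_ball.1 hx)
      rw [dist_eq_norm, add_sub_cancel_left, ContinuousMap.norm_le _ dist_nonneg]
      intro _
      simp [dist_eq_norm]
    have h2 := (ContinuousMap.dist_apply_le_dist s).trans (hball h1).le
    simpa [dist_eq_norm] using h2

theorem ContDiff.continuousMap_comp_left {K : Type*} [TopologicalSpace K] [CompactSpace K]
    {A B : Type} [NormedAddCommGroup A] [NormedSpace ℝ A] [NormedAddCommGroup B]
    [NormedSpace ℝ B] {f : A → B} (hf : ContDiff ℝ ∞ f) :
    ContDiff ℝ ∞ (fun y : C(K, A) => (⟨f, hf.continuous⟩ : C(A, B)).comp y) := by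
  rw [contDiff_infty]
  intro n
  induction n generalizing B with
  | zero => exact contDiff_zero.2 (ContinuousMap.continuous_postcomp _)
  | succ n ih =>
    have hd := ContinuousMap.hasFDerivAt_comp_left (K := K) (hf.of_le (by norm_num : (1 : ℕ∞ω) ≤ ∞))
    rw [Nat.cast_succ, contDiff_succ_iff_fderiv]
    refine ⟨fun y => (hd y).differentiableAt, fun h => by simp at h, ?_⟩
    rw [funext fun y => (hd y).fderiv]
    exact (ContinuousMap.pointwiseApplyL K A B).contDiff.comp
      (ih (hf.fderiv_right (m := ∞) (by norm_num)))

/-- The primitive vanishing at `0` of a continuous map on the unit interval. -/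
noncomputable def ContinuousMap.primitiveL (A : Type*) [NormedAddCommGroup A] [NormedSpace ℝ A] :
    C(I, A) →L[ℝ] C(I, A) :=
  LinearMap.mkContinuous
    { toFun := fun h => 
        ⟨fun s => ∫ τ in (0 : ℝ)..s, ContinuousMap.IccExtend zero_le_one h τ, by
          refine (intervalIntegral.continuous_primitive (fun a b => ?_) 0).comp
            continuous_subtype_val
          exact (map_continuous _).intervalIntegrable a b⟩
      map_add' := fun h k => by
        ext s
        exact intervalIntegral.integral_add
          ((h.IccExtend zero_le_one).continuous.intervalIntegrable _ _)
          ((k.IccExtend zero_le_one).continuous.intervalIntegrable _ _)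
      map_smul' := fun a h => by
        ext s
        exact intervalIntegral.integral_smul a _ }
    1 (fun h => by
      rw [ContinuousMap.norm_le _ (by positivity)]
      intro s
      rw [one_mul]
      refine (intervalIntegral.norm_integral_le_of_norm_le_const (C := ‖h‖) 
        fun τ _ => h.norm_coe_le_norm _).trans ?_
      rw [sub_zero, abs_of_nonneg s.2.1]
      exact mul_le_of_le_one_right (norm_nonneg _) s.2.2)

/-- The continuous linear map sending a vector to the corresponding constant map. -/
noncomputable def ContinuousMap.constantL (K : Type*) [TopologicalSpace K] [CompactSpace K]
    (A : Type*) [NormedAddCommGroup A] [NormedSpace ℝ A] : A →L[ℝ] C(K, A) :=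
  LinearMap.mkContinuous
    { toFun := ContinuousMap.const K
      map_add' := fun _ _ => rfl
      map_smul' := fun _ _ => rfl }
    1 (fun a => by
      rw [ContinuousMap.norm_le _ (by positivity), one_mul]
      exact fun _ => le_rfl)

theorem ContDiffAt.exists_openPartialHomeomorph {X Y : Type*} [NormedAddCommGroup X]
    [NormedSpace ℝ X] [CompleteSpace X] [NormedAddCommGroup Y] [NormedSpace ℝ Y] {f : X → Y}
    (hf : ContDiff ℝ ∞ f) {f' : X ≃L[ℝ] Y} {a : X} (ha : HasFDerivAt f (f' : X →L[ℝ] Y) a) :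
    ∃ e : OpenPartialHomeomorph X Y, (e : X → Y) = f ∧ a ∈ e.source ∧
      ∀ᶠ y in 𝓝 (f a), y ∈ e.target ∧ ContDiffAt ℝ ∞ e.symm y := by
  let e := (hf.contDiffAt (x := a)).toOpenPartialHomeomorph f ha (by simp)
  have hae : a ∈ e.source := ContDiffAt.mem_toOpenPartialHomeomorph_source _ ha _
  have hfe : (e : X → Y) = f := rfl
  have hinv : ∀ᶠ x in 𝓝 a, fderiv ℝ f x ∈ range ContinuousLinearEquiv.toContinuousLinearMap :=
    (hf.continuous_fderiv (by simp)).continuousAt.eventually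
      (by rw [ha.fderiv]; exact f'.nhds)
  have hmem : f a ∈ e.target := e.map_source hae
  have hsymm : Tendsto e.symm (𝓝 (f a)) (𝓝 a) := e.tendsto_symm hae
  refine ⟨e, hfe, hae, ?_⟩
  filter_upwards [e.open_target.mem_nhds hmem, hsymm.eventually hinv] with y hy ⟨g, hg⟩
  refine ⟨hy, e.contDiffAt_symm (f₀' := g) hy ?_ hf.contDiffAt⟩
  rw [hg, hfe]
  exact (hf.differentiable (by simp) _).hasFDerivAt

theorem exists_contDiffAt_local_flow {A : Type} [NormedAddCommGroup A] [NormedSpace ℝ A]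
    [CompleteSpace A] {f : ℝ × A → A} (hf : ContDiff ℝ ∞ f) (a : A) :
    ∃ x : A × ℝ → A, ∀ᶠ q in 𝓝 (a, (0 : ℝ)), ContDiffAt ℝ ∞ x q ∧ x (q.1, 0) = q.1 ∧
      HasDerivAt (fun t => x (q.1, t)) (f (q.2, x q)) q.2 := by
  let line : C(I, ℝ × A) := ⟨fun s => ((s : ℝ), 0), by fun_prop⟩
  let ins : C(I, A) →L[ℝ] C(I, ℝ × A) := (ContinuousLinearMap.inr ℝ ℝ A).compLeftContinuous ℝ I
  let H : ℝ × C(I, A) → C(I, A) := fun q => ContinuousMap.primitiveL A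
    ((⟨f, hf.continuous⟩ : C(ℝ × A, A)).comp (q.1 • line + ins q.2))
  have hH : ContDiff ℝ ∞ H := (ContinuousMap.primitiveL A).contDiff.comp
    (hf.continuousMap_comp_left.comp (by fun_prop))
  let Φ : (A × ℝ) × C(I, A) → C(I, A) := fun q =>
    q.2 - (ContinuousMap.constantL I A q.1.1 + q.1.2 • H (q.1.2, q.2))
  have hΦ : ContDiff ℝ ∞ Φ := by fun_prop
  have hΦ_apply : ∀ u t y, Φ ((u, t), y) = 0 ↔ ∀ s : I, y s = u + t • ∫ τ in (0 : ℝ)..s,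
      f (t * projIcc 0 1 zero_le_one τ, y (projIcc 0 1 zero_le_one τ)) := by
    intro u t y
    rw [sub_eq_zero, ContinuousMap.ext_iff]
    refine forall_congr' fun s => ?_
    have : H (t, y) s = ∫ τ in (0 : ℝ)..s,
      f (t * projIcc 0 1 zero_le_one τ, y (projIcc 0 1 zero_le_one τ)) := by
      refine intervalIntegral.integral_congr fun τ _ => ?_
      change f (t • ((projIcc 0 1 zero_le_one τ : ℝ), (0 : A)) + (0, y (projIcc 0 1 zero_le_one τ))) = _
      simp
    change y s = u + t • H (t, y) s ↔ _
    rw [this]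
  let y₀ := ContinuousMap.constantL I A a
  let Ψ : (A × ℝ) × C(I, A) → (A × ℝ) × C(I, A) := fun q => (q.1, Φ q)
  let S : A × ℝ →L[ℝ] C(I, A) := -(ContinuousMap.constantL I A ∘L ContinuousLinearMap.fst ℝ A ℝ +
    (ContinuousLinearMap.snd ℝ A ℝ).smulRight (H (0, y₀)))
  let Ψ' := ContinuousLinearEquiv.skewProd (ContinuousLinearEquiv.refl ℝ (A × ℝ))
    (ContinuousLinearEquiv.refl ℝ C(I, A)) S
  have hΨ : ContDiff ℝ ∞ Ψ := by fun_prop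
  have hΨ' : HasFDerivAt Ψ (Ψ' : _ →L[ℝ] (A × ℝ) × C(I, A)) ((a, 0), y₀) := by
    have hH' : HasFDerivAt (fun q : (A × ℝ) × C(I, A) => H (q.1.2, q.2))
        (fderiv ℝ (fun q : (A × ℝ) × C(I, A) => H (q.1.2, q.2)) ((a, 0), y₀)) ((a, 0), y₀) :=
      ((ContDiff.differentiable (n := ∞) (by fun_prop) (by simp)) _).hasFDerivAt
    have h1 : HasFDerivAt (fun q : (A × ℝ) × C(I, A) => q.1.1)
      (ContinuousLinearMap.fst ℝ A ℝ ∘L ContinuousLinearMap.fst ℝ (A × ℝ) C(I, A)) ((a, 0), y₀) :=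
      hasFDerivAt_fst.fst
    have h2 : HasFDerivAt (fun q : (A × ℝ) × C(I, A) => q.1.2)
      (ContinuousLinearMap.snd ℝ A ℝ ∘L ContinuousLinearMap.fst ℝ (A × ℝ) C(I, A)) ((a, 0), y₀) :=
      hasFDerivAt_fst.snd
    have h3 := (hasFDerivAt_fst (𝕜 := ℝ) (p := ((a, (0 : ℝ)), y₀))).prodMk
      ((hasFDerivAt_snd (𝕜 := ℝ) (p := ((a, (0 : ℝ)), y₀))).sub
        (((ContinuousMap.constantL I A).hasFDerivAt.comp _ h1).add (h2.smul hH')))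
    refine h3.congr_fderiv ?_
    refine ContinuousLinearMap.ext fun q => Prod.ext rfl ?_
    change q.2 - (ContinuousMap.constantL I A q.1.1 + ((0 : ℝ) • _ + q.1.2 • H (0, y₀))) =
      q.2 + -(ContinuousMap.constantL I A q.1.1 + q.1.2 • H (0, y₀))
    rw [zero_smul, zero_add, sub_eq_add_neg]
  obtain ⟨e, he, hsource, htarget⟩ := ContDiffAt.exists_openPartialHomeomorph hΨ hΨ'
  have hΨa : Ψ ((a, 0), y₀) = ((a, 0), 0) := Prod.ext rfl ((hΦ_apply a 0 y₀).2 fun s => by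
    rw [zero_smul, add_zero]; rfl)
  have hemb : Tendsto (fun q : A × ℝ => (q, (0 : C(I, A)))) (𝓝 (a, 0)) (𝓝 (Ψ ((a, 0), y₀))) := by
    rw [hΨa]
    exact Continuous.tendsto' (by fun_prop) _ _ rfl
  let Y : A × ℝ → C(I, A) := fun q => (e.symm (q, 0)).2
  have hsol : ∀ q : A × ℝ, (q, (0 : C(I, A))) ∈ e.target → Φ (q, Y q) = 0 := by
    intro q hq
    have h := e.right_inv hq
    rw [he] at h
    have h1 : (e.symm (q, 0)).1 = q := congrArg Prod.fst h
    have h2 : Φ (e.symm (q, 0)) = 0 := congrArg Prod.snd h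
    rwa [show e.symm (q, 0) = (q, Y q) from Prod.ext h1 rfl] at h2
  have huniq : ∀ (q : A × ℝ) y, (q, y) ∈ e.source → Φ (q, y) = 0 → y = Y q := by
    intro q y hq h
    have h1 := e.left_inv hq
    rw [he, show Ψ (q, y) = (q, 0) from Prod.ext rfl h] at h1
    exact (congrArg Prod.snd h1).symm
  have hYa : Y (a, 0) = y₀ := (huniq _ _ hsource (congrArg Prod.snd hΨa)).symm
  have hYsmooth : ∀ᶠ q in 𝓝 (a, (0 : ℝ)), (q, (0 : C(I, A))) ∈ e.target ∧ ContDiffAt ℝ ∞ Y q := by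
    filter_upwards [hemb.eventually htarget] with q hq
    exact ⟨hq.1, (hq.2.comp (f := fun q : A × ℝ => (q, (0 : C(I, A)))) q (by fun_prop)).snd⟩
  obtain ⟨r, hr, hball⟩ := Metric.mem_nhds_iff.1 (e.open_source.mem_nhds hsource)
  have hYclose : ∀ᶠ q in 𝓝 (a, (0 : ℝ)), dist (Y q) y₀ < r := by
    have := hYsmooth.self_of_nhds.2.continuousAt.eventually (Metric.ball_mem_nhds (Y (a, 0)) hr)
    simpa [hYa] using this
  let x : A × ℝ → A := fun q => Y q 1
  have hscale : ∀ᶠ q in 𝓝 (a, (0 : ℝ)), ∀ s : I, Y q s = x (q.1, s * q.2) := by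
    filter_upwards [hYsmooth, hYclose, Metric.ball_mem_nhds _ hr] with ⟨u, t⟩ hq hq' hqr s
    let z : C(I, A) := (Y (u, t)).comp ⟨fun τ => s * τ, by fun_prop⟩
    have hz : z = Y (u, s * t) := by
      refine huniq _ _ (hball ?_) ?_
      · rw [← ball_prod_same] at hqr ⊢
        refine ⟨?_, ?_⟩
        · rw [← ball_prod_same]
          refine ⟨hqr.1, ?_⟩
          have h1 : |t| < r := by simpa using hqr.2
          have h2 : |(s : ℝ) * t| ≤ |t| := by
            rw [abs_mul, abs_of_nonneg s.2.1]
            exact mul_le_of_le_one_left (abs_nonneg _) s.2.2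
          simpa using h2.trans_lt h1
        · refine lt_of_le_of_lt ?_ hq'
          rw [ContinuousMap.dist_le dist_nonneg]
          exact fun τ => ContinuousMap.dist_apply_le_dist (f := Y (u, t)) (g := y₀) (s * τ)
      · rw [hΦ_apply]
        intro τ
        have h1 := (hΦ_apply u t _).1 (hsol _ hq.1) (s * τ)
        refine h1.trans ?_
        have h2 := intervalIntegral.smul_integral_comp_mul_left (a := 0) (b := τ)
          (fun w : ℝ => f (t * projIcc 0 1 zero_le_one w, Y (u, t) (projIcc 0 1 zero_le_one w)))
          (s : ℝ)
        rw [mul_zero] at h2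
        rw [Set.Icc.coe_mul, ← h2, smul_smul, mul_comm t]
        congr 2
        refine intervalIntegral.integral_congr fun w hw => ?_
        rw [uIcc_of_le τ.2.1] at hw
        have hw' : w ∈ Icc (0 : ℝ) 1 := ⟨hw.1, hw.2.trans τ.2.2⟩
        have hsw : (s : ℝ) * w ∈ Icc (0 : ℝ) 1 := (s * ⟨w, hw'⟩ : I).2
        change f (t * projIcc 0 1 zero_le_one (s * w), Y (u, t) (projIcc 0 1 zero_le_one (s * w))) =
          f (s * t * projIcc 0 1 zero_le_one w, Y (u, t) (s * projIcc 0 1 zero_le_one w))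
        rw [projIcc_of_mem _ hsw, projIcc_of_mem _ hw']
        congr 2
        change t * (s * w) = s * t * w
        ring
    change Y (u, t) s = Y (u, s * t) 1
    rw [← hz]
    change Y (u, t) s = Y (u, t) (s * 1)
    rw [mul_one]
  have hint : ∀ᶠ q in 𝓝 (a, (0 : ℝ)), x q = q.1 + ∫ τ in (0 : ℝ)..q.2, f (τ, x (q.1, τ)) := by
    filter_upwards [hYsmooth, hscale] with ⟨u, t⟩ hq hqs
    have h1 := (hΦ_apply u t _).1 (hsol _ hq.1) 1
    have h2 := intervalIntegral.smul_integral_comp_mul_left (a := 0) (b := 1)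
      (fun τ : ℝ => f (τ, x (u, τ))) t
    rw [mul_zero, mul_one] at h2
    refine h1.trans ?_
    change _ = u + ∫ τ in (0 : ℝ)..t, f (τ, x (u, τ))
    rw [← h2]
    congr 2
    refine intervalIntegral.integral_congr fun w hw => ?_
    rw [Set.Icc.coe_one, uIcc_of_le zero_le_one] at hw
    rw [hqs, projIcc_of_mem _ hw, mul_comm t]
  obtain ⟨R, hR, hRball⟩ := Metric.eventually_nhds_iff_ball.1 (hYsmooth.and hint)
  have hxsmooth : ∀ q ∈ ball (a, (0 : ℝ)) R, ContDiffAt ℝ ∞ x q := fun q hq =>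
    (ContinuousMap.evalCLM ℝ (1 : I) : C(I, A) →L[ℝ] A).contDiff.contDiffAt.comp q
      (hRball q hq).1.2
  refine ⟨x, ?_⟩
  filter_upwards [Metric.ball_mem_nhds _ hR] with ⟨u, t⟩ hq
  have hmem : ∀ τ ∈ ball (0 : ℝ) R, (u, τ) ∈ ball (a, (0 : ℝ)) R := by
    intro τ hτ
    rw [← ball_prod_same] at hq ⊢
    exact ⟨hq.1, hτ⟩
  have ht : t ∈ ball (0 : ℝ) R := by
    rw [← ball_prod_same] at hq
    exact hq.2
  have hcont : ContinuousOn (fun τ => f (τ, x (u, τ))) (ball 0 R) := by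
    intro τ hτ
    have := (hxsmooth _ (hmem τ hτ)).continuousAt
    have h2 : ContinuousAt (fun τ => x (u, τ)) τ := this.comp (f := fun τ => (u, τ)) (by fun_prop)
    exact (hf.continuous.continuousAt.comp (continuousAt_id.prodMk h2)).continuousWithinAt
  refine ⟨hxsmooth _ hq, ?_, ?_⟩
  · simpa using (hRball _ (hmem 0 (mem_ball_self hR))).2
  · have hsub : uIcc 0 t ⊆ ball (0 : ℝ) R := by
      rw [← segment_eq_uIcc]
      exact (convex_ball _ _).segment_subset (mem_ball_self hR) ht
    have h1 := intervalIntegral.integral_hasDerivAt_right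
      (hcont.mono hsub).intervalIntegrable
      (hcont.stronglyMeasurableAtFilter isOpen_ball _ ht)
      (hcont.continuousAt (isOpen_ball.mem_nhds ht))
    refine (h1.const_add u).congr_of_eventuallyEq ?_
    filter_upwards [isOpen_ball.mem_nhds ht] with τ hτ
    exact (hRball _ (hmem τ hτ)).2

theorem exists_contDiff_eventuallyEq {X B : Type*} [NormedAddCommGroup X] [NormedSpace ℝ X]
    [HasContDiffBump X] [NormedAddCommGroup B] [NormedSpace ℝ B] {f : X → B} {a : X}
    (hf : ∀ᶠ q in 𝓝 a, ContDiffAt ℝ ∞ f q) : ∃ g : X → B, ContDiff ℝ ∞ g ∧ g =ᶠ[𝓝 a] f := by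
  obtain ⟨R, hR, hball⟩ := Metric.eventually_nhds_iff_ball.1 hf
  let χ : ContDiffBump a := ⟨R / 4, R / 2, by positivity, by linarith⟩
  refine ⟨fun q => χ q • f q, contDiff_iff_contDiffAt.2 fun q => ?_, ?_⟩
  · by_cases hq : q ∈ tsupport χ
    · rw [χ.tsupport_eq] at hq
      refine χ.contDiffAt.smul (hball q (closedBall_subset_ball ?_ hq))
      change R / 2 < R
      linarith
    · rw [notMem_tsupport_iff_eventuallyEq] at hq
      refine (contDiffAt_const (c := (0 : B))).congr_of_eventuallyEq ?_
      filter_upwards [hq] with z hz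
      simp [hz]
  · filter_upwards [χ.eventuallyEq_one] with q hq
    simp [hq]

theorem exists_local_flow_of_eventually_contDiffAt {A : Type} [NormedAddCommGroup A]
    [NormedSpace ℝ A] [FiniteDimensional ℝ A] {f : ℝ × A → A} {a : A}
    (hf : ∀ᶠ q in 𝓝 ((0 : ℝ), a), ContDiffAt ℝ ∞ f q) :
    ∃ x : A × ℝ → A, ∀ᶠ q in 𝓝 (a, (0 : ℝ)), ContDiffAt ℝ ∞ x q ∧ x (q.1, 0) = q.1 ∧
      HasDerivAt (fun t => x (q.1, t)) (f (q.2, x q)) q.2 := by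
  have := FiniteDimensional.complete ℝ A
  obtain ⟨g, hg, hgf⟩ := exists_contDiff_eventuallyEq hf
  obtain ⟨x, hx⟩ := exists_contDiffAt_local_flow hg a
  refine ⟨x, ?_⟩
  have hx0 : x (a, 0) = a := hx.self_of_nhds.2.1
  have hlim : Tendsto (fun q : A × ℝ => (q.2, x q)) (𝓝 (a, 0)) (𝓝 (0, a)) := by
    have : ContinuousAt (fun q : A × ℝ => (q.2, x q)) (a, 0) :=
      continuousAt_snd.prodMk hx.self_of_nhds.1.continuousAt
    simpa [ContinuousAt, hx0] using this
  filter_upwards [hx, hlim.eventually hgf] with q hq hqf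
  rw [← hqf]
  exact hq

theorem exists_orthogonal_reparametrization {Eh Fh : ℝ × ℝ → ℝ}
    (hE : ∀ᶠ q in 𝓝 ((0 : ℝ), (0 : ℝ)), ContDiffAt ℝ ∞ Eh q)
    (hF : ∀ᶠ q in 𝓝 ((0 : ℝ), (0 : ℝ)), ContDiffAt ℝ ∞ Fh q) (hpos : 0 < Eh (0, 0)) :
    ∃ (a : ℝ × ℝ → ℝ) (τ : ℝ → ℝ), τ 0 = 0 ∧ ContDiffAt ℝ ∞ τ 0 ∧ deriv τ 0 ≠ 0 ∧
      ∀ᶠ q in 𝓝 ((0 : ℝ), (0 : ℝ)), ContDiffAt ℝ ∞ a q ∧ a (q.1, 0) = τ q.1 ∧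
        pv a q = -Fh (a q, q.2) / Eh (a q, q.2) ∧ 0 < pu a q ∧
        (q.2 = 0 → pu a q = 1 / √(Eh (a q, q.2))) := by
  have hEpos : ∀ᶠ q in 𝓝 ((0 : ℝ), (0 : ℝ)), 0 < Eh q :=
    hE.self_of_nhds.continuousAt.eventually (lt_mem_nhds hpos)
  have hswap : Tendsto (fun q : ℝ × ℝ => (q.2, q.1)) (𝓝 (0, 0)) (𝓝 (0, 0)) :=
    Continuous.tendsto' (by fun_prop) _ _ rfl
  have haxis : Tendsto (fun q : ℝ × ℝ => (q.2, (0 : ℝ))) (𝓝 (0, 0)) (𝓝 (0, 0)) :=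
    Continuous.tendsto' (by fun_prop) _ _ rfl
  obtain ⟨X, hX⟩ := exists_local_flow_of_eventually_contDiffAt (a := (0 : ℝ))
    (f := fun q : ℝ × ℝ => -Fh (q.2, q.1) / Eh (q.2, q.1)) (by
      filter_upwards [hswap.eventually hE, hswap.eventually hF, hswap.eventually hEpos]
        with q h1 h2 h3
      exact ((h2.comp (f := fun q : ℝ × ℝ => (q.2, q.1)) q (by fun_prop)).neg).div
        (h1.comp (f := fun q : ℝ × ℝ => (q.2, q.1)) q (by fun_prop)) h3.ne')
  obtain ⟨Z, hZ⟩ := exists_local_flow_of_eventually_contDiffAt (a := (0 : ℝ))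
    (f := fun q : ℝ × ℝ => 1 / √(Eh (q.2, 0))) (by
      filter_upwards [haxis.eventually hE, haxis.eventually hEpos] with q h1 h3
      exact contDiffAt_const.div
        ((h1.comp (f := fun q : ℝ × ℝ => (q.2, (0 : ℝ))) q (by fun_prop)).sqrt h3.ne')
        (Real.sqrt_pos.2 h3).ne')
  let τ : ℝ → ℝ := fun u => Z (0, u)
  have hτ0 : τ 0 = 0 := hZ.self_of_nhds.2.1
  have hτ : ∀ᶠ q in 𝓝 ((0 : ℝ), (0 : ℝ)), ContDiffAt ℝ ∞ τ q.1 ∧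
      HasDerivAt τ (1 / √(Eh (τ q.1, 0))) q.1 := by
    have : Tendsto (fun q : ℝ × ℝ => ((0 : ℝ), q.1)) (𝓝 (0, 0)) (𝓝 (0, 0)) :=
      Continuous.tendsto' (by fun_prop) _ _ rfl
    filter_upwards [this.eventually hZ] with q hq
    exact ⟨hq.1.comp (f := fun u : ℝ => ((0 : ℝ), u)) q.1 (by fun_prop), hq.2.2⟩
  have hτ0' : 0 < deriv τ 0 := by
    rw [hτ.self_of_nhds.2.deriv]
    simpa [hτ0] using hpos
  let a : ℝ × ℝ → ℝ := fun q => X (τ q.1, q.2)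
  have ha0 : a (0, 0) = 0 := by
    have := hX.self_of_nhds.2.1
    simpa [a, hτ0] using this
  have hinner : Tendsto (fun q : ℝ × ℝ => (τ q.1, q.2)) (𝓝 (0, 0)) (𝓝 (0, 0)) := by
    have h1 : ContinuousAt (fun q : ℝ × ℝ => (τ q.1, q.2)) (0, 0) :=
      (hτ.self_of_nhds.1.continuousAt.comp (f := Prod.fst) continuousAt_fst).prodMk continuousAt_snd
    simpa [ContinuousAt, hτ0] using h1
  have hinner0 : Tendsto (fun q : ℝ × ℝ => (τ q.1, (0 : ℝ))) (𝓝 (0, 0)) (𝓝 (0, 0)) :=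
    ((continuous_fst.prodMk continuous_const).tendsto' ((0 : ℝ), (0 : ℝ)) (0, (0 : ℝ)) rfl).comp
      hinner
  have hasmooth : ∀ᶠ q in 𝓝 ((0 : ℝ), (0 : ℝ)), ContDiffAt ℝ ∞ a q := by
    filter_upwards [hτ, hinner.eventually hX] with q h1 h2
    exact h2.1.comp (f := fun q : ℝ × ℝ => (τ q.1, q.2)) q
      ((h1.1.comp (f := Prod.fst) q contDiffAt_fst).prodMk contDiffAt_snd)
  have haxis_val : ∀ᶠ q in 𝓝 ((0 : ℝ), (0 : ℝ)), a (q.1, 0) = τ q.1 := by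
    filter_upwards [hinner0.eventually hX] with q hq
    exact hq.2.1
  have hpu : ∀ᶠ q in 𝓝 ((0 : ℝ), (0 : ℝ)), q.2 = 0 → pu a q = 1 / √(Eh (a q, q.2)) := by
    filter_upwards [hasmooth, hτ, haxis_val.eventually_nhds] with q h1 h2 h3 h4
    obtain ⟨u, v⟩ := q
    obtain rfl : v = 0 := h4
    have h5 : HasDerivAt (fun w => a (w, 0)) (pu a (u, 0)) u :=
      ((h1.differentiableAt (by simp)).hasFDerivAt).comp_hasDerivAt (f := fun w : ℝ => (w, (0 : ℝ)))
        u ((hasDerivAt_id u).prodMk (hasDerivAt_const u 0))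
    have h6 : (fun w => a (w, 0)) =ᶠ[𝓝 u] τ :=
      (Continuous.tendsto' (by fun_prop) u (u, (0 : ℝ)) rfl :
        Tendsto (fun w : ℝ => (w, (0 : ℝ))) (𝓝 u) (𝓝 (u, 0))).eventually h3
    rw [h5.unique (h2.2.congr_of_eventuallyEq h6)]
    change _ = 1 / √(Eh (a (u, 0), 0))
    rw [h3.self_of_nhds]
  have hpu0 : 0 < pu a (0, 0) := by
    rw [hpu.self_of_nhds rfl, ha0]
    positivity
  have hpu_pos : ∀ᶠ q in 𝓝 ((0 : ℝ), (0 : ℝ)), 0 < pu a q := by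
    have h1 : ContinuousAt (pu a) (0, 0) :=
      ((hasmooth.self_of_nhds.fderiv_right (m := 0) (by simp)).continuousAt).clm_apply
        continuousAt_const
    exact h1.eventually (lt_mem_nhds hpu0)
  refine ⟨a, τ, hτ0, hτ.self_of_nhds.1, hτ0'.ne', ?_⟩
  filter_upwards [hasmooth, haxis_val, hpu_pos, hpu, hinner.eventually hX] with q h1 h2 h3 h4 h5
  refine ⟨h1, h2, ?_, h3, h4⟩
  have h6 : HasDerivAt (fun w => a (q.1, w)) (pv a q) q.2 :=
    ((h1.differentiableAt (by simp)).hasFDerivAt).comp_hasDerivAt (f := fun w : ℝ => (q.1, w))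
      q.2 ((hasDerivAt_const q.2 q.1).prodMk (hasDerivAt_id q.2))
  exact h6.unique h5.2.2

theorem gform_mul_gform_sub_sq (E F G : ℝ × ℝ → ℝ) (q v w : ℝ × ℝ) :
    gform E F G q v v * gform E F G q w w - gform E F G q v w ^ 2 =
      (E q * G q - F q * F q) * (v.1 * w.2 - v.2 * w.1) ^ 2 := by
  simp only [gform]
  ring

theorem gform_smul_self (E F G : ℝ × ℝ → ℝ) (q v : ℝ × ℝ) (r : ℝ) :
    gform E F G q (r • v) (r • v) = r ^ 2 * gform E F G q v v := by
  simp only [gform, Prod.smul_fst, Prod.smul_snd, smul_eq_mul]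
  ring

/-- A metric with positive discriminant taking a negative value is negative definite. -/
theorem gform_self_neg_of_discr_pos {E F G : ℝ × ℝ → ℝ} {q v : ℝ × ℝ}
    (hq : 0 < E q * G q - F q * F q) (hv : gform E F G q v v < 0) (w : ℝ × ℝ) (hw : w ≠ 0) :
    gform E F G q w w < 0 := by
  have h := gform_mul_gform_sub_sq E F G q v w
  by_contra hcon
  push Not at hcon
  have h1 : gform E F G q v v * gform E F G q w w ≤ 0 :=
    mul_nonpos_of_nonpos_of_nonneg hv.le hcon
  have h2 : v.1 * w.2 - v.2 * w.1 = 0 := by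
    by_contra hne
    have : 0 < (E q * G q - F q * F q) * (v.1 * w.2 - v.2 * w.1) ^ 2 := by positivity
    nlinarith [sq_nonneg (gform E F G q v w)]
  have h3 : (w.1 ^ 2 + w.2 ^ 2) * gform E F G q v v =
      (v.1 ^ 2 + v.2 ^ 2) * gform E F G q w w := by
    simp only [gform]
    linear_combination ((E q - G q) * (v.1 * w.2 + v.2 * w.1)
      + 2 * F q * (v.2 * w.2 - v.1 * w.1)) * h2
  have h4 : 0 < w.1 ^ 2 + w.2 ^ 2 := by
    rcases eq_or_ne w.1 0 with h | h
    · have : w.2 ≠ 0 := fun h' => hw (Prod.ext h h')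
      positivity
    · positivity
  nlinarith [mul_pos_of_neg_of_neg hv (neg_lt_zero.2 h4), sq_nonneg v.1, sq_nonneg v.2,
    mul_nonneg (add_nonneg (sq_nonneg v.1) (sq_nonneg v.2)) hcon]

theorem gform_self_pos_of_not_null {U : Set (ℝ × ℝ)} (hU : IsOpen U) {E F G : ℝ × ℝ → ℝ}
    (hE : ContinuousOn E U) (hF : ContinuousOn F U) (hG : ContinuousOn G U)
    (hnotneg : ∀ q ∈ U, ¬ (∀ v : ℝ × ℝ, v ≠ 0 → gform E F G q v v < 0))
    {p : ℝ × ℝ} (hp : p ∈ U) (hdiscr : E p * G p - F p * F p = 0)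
    (hadm : fderiv ℝ (fun q => E q * G q - F q * F q) p ≠ 0)
    {v w : ℝ × ℝ} (hvw : gform E F G p v w ≠ 0) : 0 < gform E F G p v v := by
  have hne : gform E F G p v v ≠ 0 := by
    intro h0
    have h := gform_mul_gform_sub_sq E F G p v w
    rw [h0, hdiscr] at h
    exact hvw (pow_eq_zero_iff two_ne_zero |>.1 (by linarith))
  refine hne.lt_or_gt.resolve_left fun hlt => ?_
  have hUp := hU.mem_nhds hp
  have hcont : ContinuousAt (fun q => gform E F G q v v) p :=
    (((hE.continuousAt hUp).mul continuousAt_const).add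
      ((hF.continuousAt hUp).mul continuousAt_const)).add
      ((hG.continuousAt hUp).mul continuousAt_const)
  refine hadm (IsLocalMax.fderiv_eq_zero ?_)
  filter_upwards [hUp, hcont.eventually (gt_mem_nhds hlt)] with q hqU hq
  rw [hdiscr]
  by_contra hpos
  exact hnotneg q hqU (gform_self_neg_of_discr_pos (not_le.1 hpos) hq)

theorem linearIndependent_pair_of_det_ne_zero_s5 {v w : ℝ × ℝ} (h : v.1 * w.2 - v.2 * w.1 ≠ 0) :
    LinearIndependent ℝ ![v, w] := by
  rw [LinearIndependent.pair_iff]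
  intro s t hst
  have h1 : s * v.1 + t * w.1 = 0 := congrArg Prod.fst hst
  have h2 : s * v.2 + t * w.2 = 0 := congrArg Prod.snd hst
  constructor
  · exact (mul_eq_zero.1 (by linear_combination w.2 * h1 - w.1 * h2 :
      s * (v.1 * w.2 - v.2 * w.1) = 0)).resolve_right h
  · exact (mul_eq_zero.1 (by linear_combination v.1 * h2 - v.2 * h1 :
      t * (v.1 * w.2 - v.2 * w.1) = 0)).resolve_right h

theorem exists_injOn_nhds_of_linearIndependent {φ : ℝ × ℝ → ℝ × ℝ} {q : ℝ × ℝ}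
    (hφ : ContDiffAt ℝ ∞ φ q) (hli : LinearIndependent ℝ ![pu φ q, pv φ q]) :
    ∃ s ∈ 𝓝 q, InjOn φ s := by
  have hinj : Function.Injective (fderiv ℝ φ q).toLinearMap := by
    rw [injective_iff_map_eq_zero]
    intro x hx
    have hx' : x.1 • pu φ q + x.2 • pv φ q = 0 := by
      rw [pu, pv, ← map_smul, ← map_smul, ← map_add]
      simpa using hx
    obtain ⟨h1, h2⟩ := LinearIndependent.pair_iff.1 hli _ _ hx'
    exact Prod.ext h1 h2
  let e : (ℝ × ℝ) ≃L[ℝ] (ℝ × ℝ) :=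
    (LinearEquiv.ofInjectiveEndo (fderiv ℝ φ q).toLinearMap hinj).toContinuousLinearEquiv
  have he : (e : (ℝ × ℝ) →L[ℝ] (ℝ × ℝ)) = fderiv ℝ φ q := by
    ext <;> simp [e]
  have hstrict : HasStrictFDerivAt φ (e : (ℝ × ℝ) →L[ℝ] (ℝ × ℝ)) q := by
    rw [he]
    exact hφ.hasStrictFDerivAt (by simp)
  refine ⟨(hstrict.toOpenPartialHomeomorph φ).source, ?_, ?_⟩
  · exact (hstrict.toOpenPartialHomeomorph φ).open_source.mem_nhds
      hstrict.mem_toOpenPartialHomeomorph_source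
  · simpa using (hstrict.toOpenPartialHomeomorph φ).injOn

/-- A function with nonzero derivative at a zero maps neighbourhoods of it onto intervals around `0`. -/
theorem exists_Ioo_subset_image_of_deriv_ne_zero {τ : ℝ → ℝ} (hτ0 : τ 0 = 0)
    (hτ : ContDiffAt ℝ ∞ τ 0) (hτ' : deriv τ 0 ≠ 0) {s : Set ℝ} (hs : s ∈ 𝓝 0) {δ : ℝ}
    (hδ : 0 < δ) : ∃ ε > 0, ε ≤ δ ∧ Ioo (-ε) ε ⊆ τ '' s := by
  have h := (hτ.hasStrictDerivAt (by simp)).map_nhds_eq hτ'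
  rw [hτ0] at h
  have h1 : τ '' s ∈ 𝓝 (0 : ℝ) := by
    rw [← h]
    exact image_mem_map hs
  obtain ⟨ε, hε, hsub⟩ := Metric.mem_nhds_iff.1 h1
  refine ⟨min ε δ, lt_min hε hδ, min_le_right _ _, fun t ht => hsub ?_⟩
  rw [Real.ball_eq_Ioo, zero_sub, zero_add]
  exact ⟨(neg_le_neg (min_le_left _ _)).trans_lt ht.1, ht.2.trans_le (min_le_left _ _)⟩

/-- Existence of an L-coordinate system associated with a non-null curve
through an admissible semidefinite point of a nowhere negative definite metric:
there is a diffeomorphism `φ` onto a neighborhood of `p` (smooth, injective,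
with linearly independent partials) such that `F̃ ≡ 0`, the image of `c` near
`p` coincides with `φ` of the `u`-axis, and `∂_v` is null along the
semidefinite set. -/
theorem exists_L_coordinate_system
    (U : Set (ℝ × ℝ)) (hU : IsOpen U)
    (E F G : ℝ × ℝ → ℝ)
    (hE : ContDiffOn ℝ (⊤ : ℕ∞) E U)
    (hF : ContDiffOn ℝ (⊤ : ℕ∞) F U)
    (hG : ContDiffOn ℝ (⊤ : ℕ∞) G U)
    (lam : ℝ × ℝ → ℝ) (hlamdef : lam = fun q => E q * G q - F q * F q)
    (hnotneg : ∀ q ∈ U, ¬ (∀ v : ℝ × ℝ, v ≠ 0 → gform E F G q v v < 0))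
    (hadm : ∀ q ∈ U, lam q = 0 → fderiv ℝ lam q ≠ 0)
    (p : ℝ × ℝ) (hp : p ∈ U) (hplam : lam p = 0)
    (δ : ℝ) (hδ : 0 < δ)
    (c : ℝ → ℝ × ℝ) (hc : ContDiffOn ℝ (⊤ : ℕ∞) c (Set.Ioo (-δ) δ))
    (hcU : ∀ t ∈ Set.Ioo (-δ) δ, c t ∈ U)
    (hc0 : c 0 = p)
    (hreg : ∀ t ∈ Set.Ioo (-δ) δ, deriv c t ≠ 0)
    (hnonnull : ∃ w : ℝ × ℝ, gform E F G p (deriv c 0) w ≠ 0) :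
    ∃ (V : Set (ℝ × ℝ)) (φ : ℝ × ℝ → ℝ × ℝ),
      IsOpen V ∧ (0, 0) ∈ V ∧
      ContDiffOn ℝ (⊤ : ℕ∞) φ V ∧
      φ (0, 0) = p ∧ (∀ q ∈ V, φ q ∈ U) ∧
      Set.InjOn φ V ∧
      (∀ q ∈ V, LinearIndependent ℝ ![pu φ q, pv φ q]) ∧
      -- orthogonal coordinates: F̃ ≡ 0 on V
      (∀ q ∈ V, gform E F G (φ q) (pu φ q) (pv φ q) = 0) ∧
      -- the image of c coincides with the u-axis near p
      (∃ ε > 0, ε ≤ δ ∧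
        (∀ t ∈ Set.Ioo (-ε) ε, c t ∈ φ '' {q ∈ V | q.2 = 0}) ∧
        (∀ q ∈ V, q.2 = 0 → φ q ∈ c '' Set.Ioo (-δ) δ)) ∧
      -- ∂_v is a null vector field along the semidefinite set
      (∀ q ∈ V, lam (φ q) = 0 →
        gform E F G (φ q) (pv φ q) (pv φ q) = 0) ∧
      -- u ↦ φ(u, 0) parametrizes c by g-arclength: Ẽ(u,0) = 1
      (∀ u : ℝ, (u, 0) ∈ V →
        gform E F G (φ (u, 0)) (pu φ (u, 0)) (pu φ (u, 0)) = 1) := by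
  subst hlamdef
  have h0 : (0 : ℝ) ∈ Set.Ioo (-δ) δ := ⟨neg_lt_zero.2 hδ, hδ⟩
  obtain ⟨w, hw⟩ := hnonnull
  have hpos : 0 < gform E F G p (deriv c 0) (deriv c 0) :=
    gform_self_pos_of_not_null hU hE.continuousOn hF.continuousOn hG.continuousOn hnotneg hp
      (hplam : E p * G p - F p * F p = 0) (hadm p hp hplam) hw
  have hcAt : ∀ t ∈ Ioo (-δ) δ, ContDiffAt ℝ ∞ c t := fun t ht =>
    hc.contDiffAt (isOpen_Ioo.mem_nhds ht)
  have hdcAt : ∀ t ∈ Ioo (-δ) δ, ContDiffAt ℝ ∞ (deriv c) t := fun t ht =>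
    (((contDiffOn_infty_iff_deriv_of_isOpen isOpen_Ioo).1 hc).2).contDiffAt
      (isOpen_Ioo.mem_nhds ht)
  let e₀ : ℝ × ℝ := (-(deriv c 0).2, (deriv c 0).1)
  let ψ : ℝ × ℝ → ℝ × ℝ := fun q => c q.1 + q.2 • e₀
  let Eh : ℝ × ℝ → ℝ := fun q => gform E F G (ψ q) (deriv c q.1) (deriv c q.1)
  let Fh : ℝ × ℝ → ℝ := fun q => gform E F G (ψ q) (deriv c q.1) e₀
  have hψ0 : ψ (0, 0) = p := by simp [ψ, hc0]
  have hfst : ∀ᶠ q in 𝓝 ((0 : ℝ), (0 : ℝ)), q.1 ∈ Ioo (-δ) δ :=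
    continuousAt_fst.eventually (isOpen_Ioo.mem_nhds h0)
  have hψAt : ∀ᶠ q in 𝓝 ((0 : ℝ), (0 : ℝ)), ContDiffAt ℝ ∞ ψ q := by
    filter_upwards [hfst] with q hq
    exact ((hcAt _ hq).comp (f := Prod.fst) q contDiffAt_fst).add
      (contDiffAt_snd.smul contDiffAt_const)
  have hψU : ∀ᶠ q in 𝓝 ((0 : ℝ), (0 : ℝ)), ψ q ∈ U :=
    hψAt.self_of_nhds.continuousAt.eventually (by rw [hψ0]; exact hU.mem_nhds hp)
  have hcoef : ∀ᶠ q in 𝓝 ((0 : ℝ), (0 : ℝ)), ContDiffAt ℝ ∞ (fun q => E (ψ q)) q ∧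
      ContDiffAt ℝ ∞ (fun q => F (ψ q)) q ∧ ContDiffAt ℝ ∞ (fun q => G (ψ q)) q ∧
      ContDiffAt ℝ ∞ (fun q : ℝ × ℝ => deriv c q.1) q := by
    filter_upwards [hfst, hψAt, hψU] with q h1 h2 h3
    exact ⟨(hE.contDiffAt (hU.mem_nhds h3)).comp q h2, (hF.contDiffAt (hU.mem_nhds h3)).comp q h2,
      (hG.contDiffAt (hU.mem_nhds h3)).comp q h2,
      (hdcAt _ h1).comp (f := Prod.fst) q contDiffAt_fst⟩
  have hEh : ∀ᶠ q in 𝓝 ((0 : ℝ), (0 : ℝ)), ContDiffAt ℝ ∞ Eh q := by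
    filter_upwards [hcoef] with q ⟨h1, h2, h3, h4⟩
    exact ((h1.mul (h4.fst.mul h4.fst)).add
      (h2.mul ((h4.fst.mul h4.snd).add (h4.snd.mul h4.fst)))).add (h3.mul (h4.snd.mul h4.snd))
  have hFh : ∀ᶠ q in 𝓝 ((0 : ℝ), (0 : ℝ)), ContDiffAt ℝ ∞ Fh q := by
    filter_upwards [hcoef] with q ⟨h1, h2, h3, h4⟩
    exact ((h1.mul (h4.fst.mul contDiffAt_const)).add
      (h2.mul ((h4.fst.mul contDiffAt_const).add (h4.snd.mul contDiffAt_const)))).add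
      (h3.mul (h4.snd.mul contDiffAt_const))
  have hEh0 : 0 < Eh (0, 0) := by
    simp only [Eh, hψ0]
    exact hpos
  have hEhpos : ∀ᶠ q in 𝓝 ((0 : ℝ), (0 : ℝ)), 0 < Eh q :=
    hEh.self_of_nhds.continuousAt.eventually (lt_mem_nhds hEh0)
  have hdet : ∀ᶠ q in 𝓝 ((0 : ℝ), (0 : ℝ)),
      0 < (deriv c q.1).1 * e₀.2 - (deriv c q.1).2 * e₀.1 := by
    have h4 := hcoef.self_of_nhds.2.2.2
    refine ((h4.fst.mul contDiffAt_const).sub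
      (h4.snd.mul contDiffAt_const)).continuousAt.eventually (lt_mem_nhds ?_)
    have hne : deriv c 0 ≠ 0 := hreg 0 h0
    simp only [e₀]
    by_contra hcon
    refine hne (Prod.ext ?_ ?_)
    · change (deriv c 0).1 = 0
      nlinarith [sq_nonneg (deriv c 0).1, sq_nonneg (deriv c 0).2]
    · change (deriv c 0).2 = 0
      nlinarith [sq_nonneg (deriv c 0).1, sq_nonneg (deriv c 0).2]
  obtain ⟨a, τ, hτ0, hτ, hτ', ha⟩ := exists_orthogonal_reparametrization hEh hFh hEh0
  have ha0 : a (0, 0) = 0 := ha.self_of_nhds.2.1.trans hτ0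
  let φ : ℝ × ℝ → ℝ × ℝ := fun q => ψ (a q, q.2)
  have hlim : Tendsto (fun q : ℝ × ℝ => (a q, q.2)) (𝓝 (0, 0)) (𝓝 (0, 0)) := by
    have h1 : ContinuousAt (fun q : ℝ × ℝ => (a q, q.2)) (0, 0) :=
      ha.self_of_nhds.1.continuousAt.prodMk continuousAt_snd
    simpa [ContinuousAt, ha0] using h1
  have hφ : ∀ᶠ q in 𝓝 ((0 : ℝ), (0 : ℝ)), ContDiffAt ℝ ∞ φ q ∧
      pu φ q = pu a q • deriv c (a q) ∧ pv φ q = pv a q • deriv c (a q) + e₀ := by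
    filter_upwards [ha, hlim.eventually hψAt, hlim.eventually hfst] with q h1 h2 h3
    refine ⟨h2.comp q (h1.1.prodMk contDiffAt_snd), ?_⟩
    have h4 : HasFDerivAt φ ((fderiv ℝ a q).smulRight (deriv c (a q)) +
        (ContinuousLinearMap.snd ℝ ℝ ℝ).smulRight e₀) q := by
      refine HasFDerivAt.add ?_ (hasFDerivAt_snd.smul_const e₀)
      exact ((((hcAt _ h3).differentiableAt (by simp)).hasDerivAt.hasFDerivAt).comp q
        ((h1.1.differentiableAt (by simp)).hasFDerivAt)).congr_fderiv (by ext <;> simp)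
    simp [pu, pv, h4.fderiv]
  have hφ0 : φ (0, 0) = p := by simp only [φ, ha0, hψ0]
  have hindep : ∀ᶠ q in 𝓝 ((0 : ℝ), (0 : ℝ)), LinearIndependent ℝ ![pu φ q, pv φ q] := by
    filter_upwards [ha, hφ, hlim.eventually hdet] with q h1 h2 h3
    refine linearIndependent_pair_of_det_ne_zero_s5 ?_
    rw [h2.2.1, h2.2.2]
    convert (mul_pos h1.2.2.2.1 h3).ne' using 1
    simp only [Prod.smul_fst, Prod.smul_snd, Prod.fst_add, Prod.snd_add, smul_eq_mul]
    ring
  obtain ⟨s, hs, hinj⟩ :=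
    exists_injOn_nhds_of_linearIndependent hφ.self_of_nhds.1 hindep.self_of_nhds
  have hτmem : ∀ᶠ q in 𝓝 ((0 : ℝ), (0 : ℝ)), a q ∈ Ioo (-δ) δ := hlim.eventually hfst
  obtain ⟨V, hVsub, hVopen, hV0⟩ := _root_.mem_nhds_iff.1
    (ha.and (hφ.and (hindep.and ((hlim.eventually hψU).and ((hlim.eventually hEhpos).and
      (hτmem.and hs))))))
  have hE1 : ∀ q ∈ V, gform E F G (φ q) (pu φ q) (pu φ q) = pu a q ^ 2 * Eh (a q, q.2) := by
    intro q hq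
    obtain ⟨-, ⟨-, h1, -⟩, -⟩ := hVsub hq
    rw [h1, gform_smul_self]
  have horth : ∀ q ∈ V, gform E F G (φ q) (pu φ q) (pv φ q) = 0 := by
    intro q hq
    obtain ⟨h1, ⟨-, h2, h3⟩, -, -, h4, -⟩ := hVsub hq
    have h5 : gform E F G (φ q) (pu φ q) (pv φ q) =
        pu a q * (pv a q * Eh (a q, q.2) + Fh (a q, q.2)) := by
      rw [h2, h3]
      simp only [gform, Eh, Fh, φ, Prod.smul_fst, Prod.smul_snd, Prod.fst_add, Prod.snd_add,
        smul_eq_mul]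
      ring
    rw [h5, h1.2.2.1, div_mul_cancel₀ _ h4.ne', neg_add_cancel, mul_zero]
  have haxis : ∀ u, (u, (0 : ℝ)) ∈ V → φ (u, 0) = c (τ u) := by
    intro u hu
    have h1 : a (u, 0) = τ u := (hVsub hu).1.2.1
    simp [φ, ψ, h1]
  refine ⟨V, φ, hVopen, hV0, fun q hq => (hVsub hq).2.1.1.contDiffWithinAt, hφ0,
    fun q hq => (hVsub hq).2.2.2.1, hinj.mono fun q hq => (hVsub hq).2.2.2.2.2.2,
    fun q hq => (hVsub hq).2.2.1, horth, ?_, ?_, ?_⟩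
  · have hV' : {u : ℝ | (u, (0 : ℝ)) ∈ V} ∈ 𝓝 (0 : ℝ) :=
      (Continuous.tendsto' (by fun_prop) (0 : ℝ) ((0 : ℝ), (0 : ℝ)) rfl :
        Tendsto (fun u : ℝ => (u, (0 : ℝ))) _ _).eventually (hVopen.mem_nhds hV0)
    obtain ⟨ε, hε, hεδ, hsub⟩ := exists_Ioo_subset_image_of_deriv_ne_zero hτ0 hτ hτ' hV' hδ
    refine ⟨ε, hε, hεδ, fun t ht => ?_, ?_⟩
    · obtain ⟨u, hu, rfl⟩ := hsub ht
      exact ⟨(u, 0), ⟨hu, rfl⟩, haxis u hu⟩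
    · rintro ⟨u, v⟩ hq rfl
      exact ⟨a (u, 0), (hVsub hq).2.2.2.2.2.1, by simp [φ, ψ]⟩
  · intro q hq hlam
    obtain ⟨h1, -, -, -, h4, -⟩ := hVsub hq
    have h5 := gform_mul_gform_sub_sq E F G (φ q) (pu φ q) (pv φ q)
    have hdiscr : E (φ q) * G (φ q) - F (φ q) * F (φ q) = 0 := hlam
    rw [horth q hq, hdiscr, hE1 q hq] at h5
    have h6 : pu a q ^ 2 * Eh (a q, q.2) ≠ 0 := (mul_pos (pow_pos h1.2.2.2.1 2) h4).ne'
    exact (mul_eq_zero.1 (by linarith)).resolve_left h6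
  · intro u hu
    obtain ⟨h1, -, -, -, h4, -⟩ := hVsub hu
    rw [hE1 _ hu, h1.2.2.2.2 rfl, div_pow, Real.sq_sqrt h4.le]
    field_simp
end
end

section
/- Let f : Ū → 𝕃³ be a smooth immersion, where Ū ⊆ ℝ² is an open neighborhood of p = (0,0), such that ⟨f_u, f_v⟩ ≡ 0 on Ū, E := ⟨f_u, f_u⟩ > 0 on Ū, G := ⟨f_v, f_v⟩, G(p) = 0 and dG(p) ≠ 0 (so p is a non-degenerate lightlike point and the lightlike set near p is LD = {G = 0}). Let ε ∈ {1, −1} be such that f_u × f_v = ε√E·f_v at every point of LD near p. Then there exist an open neighborhood U ⊆ Ū of p and a smooth map ψ : U → ℝ³ such that f_u × f_v = ε√E·(f_v − G·ψ) on U; moreover any such ψ satisfies ⟨ψ, ψ⟩ = 0, ⟨ψ, f_u⟩ = 0 and ⟨ψ, f_v⟩ = 1 on U. (Such a map ψ is called an L-Gauss map of f.) -/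
noncomputable section

/-- The Minkowski inner product of signature (+,+,−) on ℝ³. -/
def mink (x y : Fin 3 → ℝ) : ℝ := x 0 * y 0 + x 1 * y 1 - x 2 * y 2

/-- The Lorentzian vector product `v × w = S (v ×ₑ w)`, `S = diag(1,1,−1)`. -/
def lcross (v w : Fin 3 → ℝ) : Fin 3 → ℝ :=
  ![v 1 * w 2 - v 2 * w 1, v 2 * w 0 - v 0 * w 2, -(v 0 * w 1 - v 1 * w 0)]

theorem mink_comm (x y : Fin 3 → ℝ) : mink x y = mink y x := by
  simp only [mink]; ring

theorem mink_add_left (x y z : Fin 3 → ℝ) : mink (x + y) z = mink x z + mink y z := by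
  simp only [mink, Pi.add_apply]; ring

theorem mink_sub_left (x y z : Fin 3 → ℝ) : mink (x - y) z = mink x z - mink y z := by
  simp only [mink, Pi.sub_apply]; ring

theorem mink_smul_left (c : ℝ) (x y : Fin 3 → ℝ) : mink (c • x) y = c * mink x y := by
  simp only [mink, Pi.smul_apply, smul_eq_mul]; ring

theorem mink_add_right (x y z : Fin 3 → ℝ) : mink x (y + z) = mink x y + mink x z := by
  simp only [mink, Pi.add_apply]; ring

theorem mink_sub_right (x y z : Fin 3 → ℝ) : mink x (y - z) = mink x y - mink x z := by
  simp only [mink, Pi.sub_apply]; ring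

theorem mink_smul_right (c : ℝ) (x y : Fin 3 → ℝ) : mink x (c • y) = c * mink x y := by
  simp only [mink, Pi.smul_apply, smul_eq_mul]; ring

theorem mink_lcross_left (v w : Fin 3 → ℝ) : mink (lcross v w) v = 0 := by
  simp [mink, lcross]; ring

theorem mink_lcross_right (v w : Fin 3 → ℝ) : mink (lcross v w) w = 0 := by
  simp [mink, lcross]; ring

/-- The Lagrange identity for the Lorentzian vector product. -/
theorem mink_lcross_self (v w : Fin 3 → ℝ) :
    mink (lcross v w) (lcross v w) = mink v w ^ 2 - mink v v * mink w w := by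
  simp [mink, lcross]; ring

theorem ContDiffOn.mink {F : Type*} [NormedAddCommGroup F] [NormedSpace ℝ F] {n : WithTop ℕ∞}
    {s : Set F} {g h : F → Fin 3 → ℝ} (hg : ContDiffOn ℝ n g s) (hh : ContDiffOn ℝ n h s) :
    ContDiffOn ℝ n (fun q => mink (g q) (h q)) s := by
  rw [contDiffOn_pi] at hg hh
  exact (((hg 0).mul (hh 0)).add ((hg 1).mul (hh 1))).sub ((hg 2).mul (hh 2))

theorem ContDiffOn.lcross {F : Type*} [NormedAddCommGroup F] [NormedSpace ℝ F] {n : WithTop ℕ∞}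
    {s : Set F} {g h : F → Fin 3 → ℝ} (hg : ContDiffOn ℝ n g s) (hh : ContDiffOn ℝ n h s) :
    ContDiffOn ℝ n (fun q => lcross (g q) (h q)) s := by
  rw [contDiffOn_pi] at hg hh ⊢
  intro i
  fin_cases i
  · exact ((hg 1).mul (hh 2)).sub ((hg 2).mul (hh 1))
  · exact ((hg 2).mul (hh 0)).sub ((hg 0).mul (hh 2))
  · exact (((hg 0).mul (hh 1)).sub ((hg 1).mul (hh 0))).neg

/-- The reflection `diag(1,1,−1)`, which turns `mink` into the Euclidean inner product. -/
def timeReflection (b : Fin 3 → ℝ) : Fin 3 → ℝ := ![b 0, b 1, -b 2]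

theorem mink_timeReflection_pos {b : Fin 3 → ℝ} (hb : b ≠ 0) : 0 < mink (timeReflection b) b := by
  have h : mink (timeReflection b) b = b 0 ^ 2 + b 1 ^ 2 + b 2 ^ 2 := by
    simp [mink, timeReflection]; ring
  rw [h]
  by_contra! hle
  apply hb
  have h0 := sq_nonneg (b 0)
  have h1 := sq_nonneg (b 1)
  have h2 := sq_nonneg (b 2)
  funext i
  fin_cases i
  · exact pow_eq_zero_iff two_ne_zero |>.1 (by linarith : b 0 ^ 2 = 0)
  · exact pow_eq_zero_iff two_ne_zero |>.1 (by linarith : b 1 ^ 2 = 0)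
  · exact pow_eq_zero_iff two_ne_zero |>.1 (by linarith : b 2 ^ 2 = 0)

theorem ContDiffOn.timeReflection {F : Type*} [NormedAddCommGroup F] [NormedSpace ℝ F]
    {n : WithTop ℕ∞} {s : Set F} {g : F → Fin 3 → ℝ} (hg : ContDiffOn ℝ n g s) :
    ContDiffOn ℝ n (fun q => timeReflection (g q)) s := by
  rw [contDiffOn_pi] at hg ⊢
  intro i
  fin_cases i
  · exact hg 0
  · exact hg 1
  · exact (hg 2).neg

/-- The projection of `timeReflection b` to the orthogonal complement of `x`. -/
def projReflection (x b : Fin 3 → ℝ) : Fin 3 → ℝ :=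
  timeReflection b - (mink (timeReflection b) x / mink x x) • x

/-- For spacelike `x` and null `b ⊥ x`, `b ≠ 0`, this is the null vector orthogonal to `x` whose
product with `b` is `2`. -/
def nullDual (x b : Fin 3 → ℝ) : Fin 3 → ℝ :=
  (2 / mink (timeReflection b) b) • (projReflection x b -
    (mink (projReflection x b) (projReflection x b) / (2 * mink (timeReflection b) b)) • b)

theorem mink_projReflection_left {x : Fin 3 → ℝ} (b : Fin 3 → ℝ) (hx : mink x x ≠ 0) :
    mink (projReflection x b) x = 0 := by
  rw [projReflection, mink_sub_left, mink_smul_left]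
  field_simp
  ring

theorem mink_projReflection_right {x b : Fin 3 → ℝ} (hxb : mink x b = 0) :
    mink (projReflection x b) b = mink (timeReflection b) b := by
  rw [projReflection, mink_sub_left, mink_smul_left, hxb, mul_zero, sub_zero]

theorem mink_nullDual_left {x b : Fin 3 → ℝ} (hx : mink x x ≠ 0) (hxb : mink x b = 0) :
    mink (nullDual x b) x = 0 := by
  rw [nullDual, mink_smul_left, mink_sub_left, mink_smul_left, mink_projReflection_left b hx,
    mink_comm b x, hxb]
  ring

theorem mink_nullDual_right {x b : Fin 3 → ℝ} (hxb : mink x b = 0) (hb : b ≠ 0)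
    (hbb : mink b b = 0) : mink (nullDual x b) b = 2 := by
  have hq := (mink_timeReflection_pos hb).ne'
  rw [nullDual, mink_smul_left, mink_sub_left, mink_smul_left, mink_projReflection_right hxb, hbb]
  field_simp
  ring

theorem mink_nullDual_self {x b : Fin 3 → ℝ} (hxb : mink x b = 0) (hb : b ≠ 0)
    (hbb : mink b b = 0) : mink (nullDual x b) (nullDual x b) = 0 := by
  have hq := (mink_timeReflection_pos hb).ne'
  simp only [nullDual, mink_smul_left, mink_sub_left, mink_smul_right, mink_sub_right,
    mink_comm b (projReflection x b), mink_projReflection_right hxb, hbb]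
  field_simp
  ring

theorem ContDiffOn.nullDual {F : Type*} [NormedAddCommGroup F] [NormedSpace ℝ F] {n : WithTop ℕ∞}
    {s : Set F} {g h : F → Fin 3 → ℝ} (hg : ContDiffOn ℝ n g s) (hh : ContDiffOn ℝ n h s)
    (hg0 : ∀ q ∈ s, _root_.mink (g q) (g q) ≠ 0) (hh0 : ∀ q ∈ s, h q ≠ 0) :
    ContDiffOn ℝ n (fun q => nullDual (g q) (h q)) s := by
  have hq := hh.timeReflection.mink hh
  have hq0 : ∀ q ∈ s, _root_.mink (_root_.timeReflection (h q)) (h q) ≠ 0 :=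
    fun q hqs => (mink_timeReflection_pos (hh0 q hqs)).ne'
  have ht : ContDiffOn ℝ n (fun q => projReflection (g q) (h q)) s :=
    hh.timeReflection.sub (((hh.timeReflection.mink hg).div (hg.mink hg) hg0).smul hg)
  exact (contDiffOn_const.div hq hq0).smul (ht.sub (((ht.mink ht).div (contDiffOn_const.mul hq)
    fun q hqs => mul_ne_zero two_ne_zero (hq0 q hqs)).smul hh))

/-- A vector orthogonal to a frame `x`, `b`, `y`, with `x` non-null and `b`, `y` null vectors
orthogonal to `x` and not to each other, vanishes. -/
theorem eq_zero_of_mink_eq_zero {x b y d : Fin 3 → ℝ} (hx : mink x x ≠ 0) (hxb : mink x b = 0)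
    (hxy : mink y x = 0) (hbb : mink b b = 0) (hyy : mink y y = 0) (hyb : mink y b = 2)
    (hdx : mink d x = 0) (hdb : mink d b = 0) (hdy : mink d y = 0) : d = 0 := by
  let M : Matrix (Fin 3) (Fin 3) ℝ := !![x 0, x 1, -x 2; b 0, b 1, -b 2; y 0, y 1, -y 2]
  have hgram : M.det ^ 2 = 4 * mink x x := by
    have h : M.det ^ 2 = -(mink x x * (mink b b * mink y y - mink y b ^ 2)
        - mink x b * (mink x b * mink y y - mink y b * mink y x)
        + mink y x * (mink x b * mink y b - mink b b * mink y x)) := by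
      simp only [M, Matrix.det_fin_three, mink, Matrix.of_apply, Matrix.cons_val]
      ring
    rw [h, hxb, hxy, hbb, hyy, hyb]
    ring
  have hdet : M.det ≠ 0 := by
    intro h
    rw [h] at hgram
    exact hx (by linarith)
  apply Matrix.eq_zero_of_mulVec_eq_zero hdet
  simp only [mink] at hdx hdb hdy
  funext i
  fin_cases i <;> simp [M, Matrix.mulVec, dotProduct, Fin.sum_univ_three] <;> linarith

theorem eq_smul_nullDual {x a b : Fin 3 → ℝ} {c : ℝ} (hx : mink x x ≠ 0) (hxb : mink x b = 0)
    (hb : b ≠ 0) (hbb : mink b b = 0) (hax : mink a x = 0) (haa : mink a a = 0)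
    (hab : mink a b = 2 * c) (hc : c = 0 → a = 0) : a = c • nullDual x b := by
  by_cases hc0 : c = 0
  · rw [hc hc0, hc0, zero_smul]
  have hyx := mink_nullDual_left hx hxb
  have hyb := mink_nullDual_right hxb hb hbb
  have hyy := mink_nullDual_self hxb hb hbb
  set y := nullDual x b
  have hd : a - c • y - (mink a y / 2) • b = 0 := by
    apply eq_zero_of_mink_eq_zero hx hxb hyx hbb hyy hyb <;>
      simp only [mink_sub_left, mink_smul_left, hyx, hyb, hyy, hax, hab, hbb, mink_comm b x, hxb,
        mink_comm b y] <;> ring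
  have ha : a = c • y + (mink a y / 2) • b := by
    rw [sub_sub, sub_eq_zero] at hd
    exact hd
  have hay : mink a y = 0 := by
    have h := haa
    rw [ha] at h
    simp only [mink_add_left, mink_add_right, mink_smul_left, mink_smul_right, hyy, hbb, hyb,
      mink_comm b y] at h
    have h' : c * mink a y = 0 := by linarith
    exact (mul_eq_zero.1 h').resolve_left hc0
  rw [hay] at ha
  simpa using ha

/-- A function with non-vanishing derivative is non-zero at points arbitrarily close to any given
point. -/
theorem frequently_ne_zero_of_fderiv_ne_zero {F : Type*} [NormedAddCommGroup F] [NormedSpace ℝ F]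
    {g : F → ℝ} {q : F} (h : fderiv ℝ g q ≠ 0) : ∃ᶠ z in nhds q, g z ≠ 0 := by
  intro hev
  apply h
  have h0 : g =ᶠ[nhds q] fun _ => (0 : ℝ) := hev.mono fun z hz => not_not.1 hz
  rw [h0.fderiv_eq]
  simp

/-- A relation `x × v = s (v − c y)` with `c ≠ 0` determines the products of `y`. -/
theorem mink_of_lcross_eq {x v y : Fin 3 → ℝ} {s : ℝ} (hx : mink x x ≠ 0)
    (hs : s ^ 2 = mink x x) (hxv : mink x v = 0) (hv : mink v v ≠ 0)
    (h : lcross x v = s • (v - mink v v • y)) :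
    mink y y = 0 ∧ mink y x = 0 ∧ mink y v = 1 := by
  have hs0 : s ≠ 0 := by
    rintro rfl
    exact hx (by rw [← hs]; ring)
  have hl := mink_lcross_left x v
  have hr := mink_lcross_right x v
  have hn := mink_lcross_self x v
  rw [h] at hl hr hn
  simp only [mink_sub_left, mink_sub_right, mink_smul_left, mink_smul_right, mink_comm v x, hxv,
    mink_comm v y] at hl hr hn
  have hyx : mink y x = 0 := by
    apply mul_left_cancel₀ (mul_ne_zero hs0 hv)
    linarith
  have hyv : mink y v = 1 := by
    apply mul_left_cancel₀ (mul_ne_zero hs0 hv)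
    linarith
  refine ⟨?_, hyx, hyv⟩
  rw [hyv, ← hs] at hn
  apply mul_left_cancel₀ (pow_ne_zero 2 (mul_ne_zero hs0 hv))
  linarith


/-- Existence of the L-Gauss map. In L-coordinates around a
non-degenerate lightlike point `p = (0,0)` (so `⟨f_u,f_v⟩ ≡ 0`, `E > 0`,
`G(p) = 0`, `dG(p) ≠ 0`), with `ε ∈ {1,−1}` such that
`f_u × f_v = ε√E·f_v` along the lightlike set near `p`, there exist a
neighborhood `U` of `p` and a smooth map `ψ` with
`f_u × f_v = ε√E·(f_v − G·ψ)` on `U`; moreover any such `ψ` satisfies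
`⟨ψ,ψ⟩ = 0`, `⟨ψ,f_u⟩ = 0`, `⟨ψ,f_v⟩ = 1` on `U`. -/
theorem exists_L_Gauss_map
    (U0 : Set (ℝ × ℝ)) (hU0 : IsOpen U0) (h00 : (0, 0) ∈ U0)
    (f : ℝ × ℝ → Fin 3 → ℝ) (hf : ContDiffOn ℝ (⊤ : ℕ∞) f U0)
    (himm : ∀ q ∈ U0, LinearIndependent ℝ ![pu f q, pv f q])
    (E G : ℝ × ℝ → ℝ)
    (hE : E = fun q => mink (pu f q) (pu f q))
    (hG : G = fun q => mink (pv f q) (pv f q))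
    (hFzero : ∀ q ∈ U0, mink (pu f q) (pv f q) = 0)
    (hEpos : ∀ q ∈ U0, 0 < E q)
    (hG0 : G (0, 0) = 0)
    (hdG : fderiv ℝ G (0, 0) ≠ 0)
    (ε : ℝ) (hε : ε = 1 ∨ ε = -1)
    (W : Set (ℝ × ℝ)) (hW : IsOpen W) (h0W : (0, 0) ∈ W) (hWU : W ⊆ U0)
    (hsign : ∀ q ∈ W, G q = 0 →
      lcross (pu f q) (pv f q) = (ε * Real.sqrt (E q)) • pv f q) :
    ∃ U : Set (ℝ × ℝ), IsOpen U ∧ (0, 0) ∈ U ∧ U ⊆ U0 ∧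
      (∃ ψ : ℝ × ℝ → Fin 3 → ℝ, ContDiffOn ℝ (⊤ : ℕ∞) ψ U ∧
        ∀ q ∈ U, lcross (pu f q) (pv f q)
          = (ε * Real.sqrt (E q)) • (pv f q - G q • ψ q)) ∧
      (∀ ψ : ℝ × ℝ → Fin 3 → ℝ, ContDiffOn ℝ (⊤ : ℕ∞) ψ U →
        (∀ q ∈ U, lcross (pu f q) (pv f q)
          = (ε * Real.sqrt (E q)) • (pv f q - G q • ψ q)) →
        ∀ q ∈ U, mink (ψ q) (ψ q) = 0 ∧ mink (ψ q) (pu f q) = 0 ∧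
          mink (ψ q) (pv f q) = 1) := by
  have hdf : ContDiffOn ℝ (⊤ : ℕ∞) (fderiv ℝ f) U0 := hf.fderiv_of_isOpen hU0 (by simp)
  have hu : ContDiffOn ℝ (⊤ : ℕ∞) (pu f) U0 := hdf.clm_apply contDiffOn_const
  have hv : ContDiffOn ℝ (⊤ : ℕ∞) (pv f) U0 := hdf.clm_apply contDiffOn_const
  have hEs : ContDiffOn ℝ (⊤ : ℕ∞) E U0 := hE ▸ hu.mink hu
  have hGs : ContDiffOn ℝ (⊤ : ℕ∞) G U0 := hG ▸ hv.mink hv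
  have hE' : ∀ q, mink (pu f q) (pu f q) = E q := fun q => by rw [hE]
  have hG' : ∀ q, mink (pv f q) (pv f q) = G q := fun q => by rw [hG]
  have hdG' : ContinuousOn (fderiv ℝ G) U0 := hGs.continuousOn_fderiv_of_isOpen hU0 (by simp)
  have hεsq : ε ^ 2 = 1 := by rcases hε with rfl | rfl <;> norm_num
  let s : ℝ × ℝ → ℝ := fun q => ε * Real.sqrt (E q)
  have hssq : ∀ q ∈ U0, s q ^ 2 = E q := fun q hq => by
    rw [mul_pow, hεsq, one_mul, Real.sq_sqrt (hEpos q hq).le]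
  have hs0 : ∀ q ∈ U0, s q ≠ 0 := fun q hq h => by
    have := hssq q hq
    rw [h] at this
    have := hEpos q hq
    linarith
  have hss : ContDiffOn ℝ (⊤ : ℕ∞) s U0 :=
    contDiffOn_const.mul (hEs.sqrt fun q hq => (hEpos q hq).ne')
  let N : ℝ × ℝ → Fin 3 → ℝ := fun q => (s q)⁻¹ • lcross (pu f q) (pv f q)
  have hN : ContDiffOn ℝ (⊤ : ℕ∞) N U0 := (hss.inv hs0).smul (hu.lcross hv)
  let b : ℝ × ℝ → Fin 3 → ℝ := fun q => pv f q + N q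
  have hb : ContDiffOn ℝ (⊤ : ℕ∞) b U0 := hv.add hN
  have hN0 : ∀ q ∈ W, G q = 0 → N q = pv f q := fun q hq hGq => by
    change (s q)⁻¹ • lcross (pu f q) (pv f q) = pv f q
    rw [hsign q hq hGq, smul_smul, inv_mul_cancel₀ (hs0 q (hWU hq)), one_smul]
  have hb0 : b (0, 0) ≠ 0 := by
    change pv f (0, 0) + N (0, 0) ≠ 0
    rw [hN0 _ h0W hG0, ← two_smul ℝ]
    exact smul_ne_zero two_ne_zero ((himm _ h00).ne_zero 1)
  have hopen : IsOpen ((U0 ∩ b ⁻¹' {0}ᶜ) ∩ (U0 ∩ fderiv ℝ G ⁻¹' {0}ᶜ)) :=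
    (hb.continuousOn.isOpen_inter_preimage hU0 isOpen_compl_singleton).inter
      (hdG'.isOpen_inter_preimage hU0 isOpen_compl_singleton)
  refine ⟨W ∩ ((U0 ∩ b ⁻¹' {0}ᶜ) ∩ (U0 ∩ fderiv ℝ G ⁻¹' {0}ᶜ)), hW.inter hopen,
    ⟨h0W, ⟨h00, hb0⟩, h00, hdG⟩, fun q hq => hWU hq.1, ?_, ?_⟩
  · refine ⟨fun q => nullDual (pu f q) (b q), ?_, ?_⟩
    · refine (hu.mono fun q hq => hWU hq.1).nullDual (hb.mono fun q hq => hWU hq.1) ?_ ?_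
      · exact fun q hq => hE' q ▸ (hEpos q (hWU hq.1)).ne'
      · exact fun q hq => hq.2.1.2
    · intro q hq
      have hq0 := hWU hq.1
      have hx : mink (pu f q) (pu f q) ≠ 0 := hE' q ▸ (hEpos q hq0).ne'
      have hNx : mink (N q) (pu f q) = 0 := by
        simp only [N, mink_smul_left, mink_lcross_left, mul_zero]
      have hNv : mink (N q) (pv f q) = 0 := by
        simp only [N, mink_smul_left, mink_lcross_right, mul_zero]
      have hNN : mink (N q) (N q) = -G q := by
        have := hs0 q hq0
        simp only [N, mink_smul_left, mink_smul_right, mink_lcross_self, hFzero q hq0, hE', hG',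
          ← hssq q hq0]
        field_simp
        ring
      have hF := hFzero q hq0
      have key : pv f q - N q = G q • nullDual (pu f q) (b q) := by
        apply eq_smul_nullDual hx _ hq.2.1.2
        case hc => exact fun h => sub_eq_zero.2 (hN0 q hq.1 h).symm
        all_goals
          simp only [b, mink_add_left, mink_add_right, mink_sub_left, mink_sub_right,
            mink_comm (pu f q) (N q), mink_comm (pv f q) (N q), mink_comm (pv f q) (pu f q),
            hNx, hNv, hNN, hF, hG']
          ring
      rw [← key, sub_sub_cancel]
      change _ = s q • (s q)⁻¹ • lcross (pu f q) (pv f q)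
      rw [smul_smul, mul_inv_cancel₀ (hs0 q hq0), one_smul]
  · intro ψ hψ h q hq
    have hUo : IsOpen (W ∩ ((U0 ∩ b ⁻¹' {0}ᶜ) ∩ (U0 ∩ fderiv ℝ G ⁻¹' {0}ᶜ))) := hW.inter hopen
    set U := W ∩ ((U0 ∩ b ⁻¹' {0}ᶜ) ∩ (U0 ∩ fderiv ℝ G ⁻¹' {0}ᶜ))
    have hfreq : ∃ᶠ z in nhds q, mink (ψ z) (ψ z) = 0 ∧ mink (ψ z) (pu f z) = 0 ∧
        mink (ψ z) (pv f z) = 1 := by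
      refine ((frequently_ne_zero_of_fderiv_ne_zero hq.2.2.2).and_eventually
        (hUo.mem_nhds hq)).mono fun z ⟨hz, hzU⟩ => ?_
      have hz0 := hWU hzU.1
      refine mink_of_lcross_eq (s := s z) ?_ ?_ (hFzero z hz0) ?_ ?_
      · exact hE' z ▸ (hEpos z hz0).ne'
      · rw [hE', hssq z hz0]
      · rwa [hG']
      · rw [hG']
        exact h z hzU
    have hlim : ∀ {g : ℝ × ℝ → ℝ} {c : ℝ}, ContDiffOn ℝ (⊤ : ℕ∞) g U →
        (∃ᶠ z in nhds q, g z = c) → g q = c := fun {g c} hg hgc =>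
      isClosed_singleton.mem_of_frequently_of_tendsto hgc
        (hg.continuousOn.continuousAt (hUo.mem_nhds hq))
    have hUU : U ⊆ U0 := fun z hz => hWU hz.1
    exact ⟨hlim (hψ.mink hψ) (hfreq.mono fun z hz => hz.1),
      hlim (hψ.mink (hu.mono hUU)) (hfreq.mono fun z hz => hz.2.1),
      hlim (hψ.mink (hv.mono hUU)) (hfreq.mono fun z hz => hz.2.2)⟩
end
end

section
/- Let f : U → 𝕃³ be a smooth immersion on an open set U ⊆ ℝ² with ⟨f_u, f_v⟩ ≡ 0 and E := ⟨f_u, f_u⟩ > 0, let G := ⟨f_v, f_v⟩, and let ψ : U → ℝ³ be an L-Gauss map of f with sign ε ∈ {1, −1}. Then det(f_u, f_v, ψ) = ε√E at every point of U; in particular the vectors f_u(q), f_v(q), ψ(q) are linearly independent for every q ∈ U. -/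
noncomputable section

/-- The scalar triple product `⟨v × w, x⟩` equals the determinant with rows `v`, `w`, `x`. -/
theorem mink_lcross_eq_det (v w x : Fin 3 → ℝ) :
    mink (lcross v w) x = Matrix.det (Matrix.of ![v, w, x]) := by
  simp [mink, lcross, Matrix.det_fin_three]
  ring

theorem mink_smul_sub_smul (c g : ℝ) (w p x : Fin 3 → ℝ) :
    mink (c • (w - g • p)) x = c * (mink x w - g * mink p x) := by
  simp [mink]
  ring

/-- For an L-Gauss map `ψ` of `f` with sign `ε` (in L-coordinates),
`det(f_u, f_v, ψ) = ε√E` at every point of `U`; in particular `f_u`, `f_v`, `ψ`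
are linearly independent at every point. -/
theorem L_Gauss_map_frame_det
    (U : Set (ℝ × ℝ)) (hU : IsOpen U)
    (f : ℝ × ℝ → Fin 3 → ℝ) (hf : ContDiffOn ℝ (⊤ : ℕ∞) f U)
    (himm : ∀ q ∈ U, LinearIndependent ℝ ![pu f q, pv f q])
    (E G : ℝ × ℝ → ℝ)
    (hE : E = fun q => mink (pu f q) (pu f q))
    (hG : G = fun q => mink (pv f q) (pv f q))
    (hFzero : ∀ q ∈ U, mink (pu f q) (pv f q) = 0)
    (hEpos : ∀ q ∈ U, 0 < E q)
    (ε : ℝ) (hε : ε = 1 ∨ ε = -1)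
    (ψ : ℝ × ℝ → Fin 3 → ℝ) (hψ : ContDiffOn ℝ (⊤ : ℕ∞) ψ U)
    (hLG : ∀ q ∈ U, lcross (pu f q) (pv f q)
      = (ε * Real.sqrt (E q)) • (pv f q - G q • ψ q))
    (hψψ : ∀ q ∈ U, mink (ψ q) (ψ q) = 0)
    (hψu : ∀ q ∈ U, mink (ψ q) (pu f q) = 0)
    (hψv : ∀ q ∈ U, mink (ψ q) (pv f q) = 1) :
    ∀ q ∈ U,
      Matrix.det (Matrix.of ![pu f q, pv f q, ψ q]) = ε * Real.sqrt (E q) ∧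
      LinearIndependent ℝ ![pu f q, pv f q, ψ q] := by
  intro q hq
  have hdet : Matrix.det (Matrix.of ![pu f q, pv f q, ψ q]) = ε * Real.sqrt (E q) := by
    rw [← mink_lcross_eq_det, hLG q hq, mink_smul_sub_smul, hψv q hq, hψψ q hq]
    ring
  have hne : ε * Real.sqrt (E q) ≠ 0 :=
    mul_ne_zero (by rcases hε with rfl | rfl <;> norm_num) (Real.sqrt_pos.2 (hEpos q hq)).ne'
  exact ⟨hdet, Matrix.linearIndependent_rows_of_det_ne_zero (hdet ▸ hne)⟩
end
end

section
/- Let f : U → 𝕃³ be a smooth immersion on an open set U ⊆ ℝ² with ⟨f_u, f_v⟩ ≡ 0 and E := ⟨f_u, f_u⟩ > 0, let G := ⟨f_v, f_v⟩, let ψ : U → ℝ³ be an L-Gauss map of f with sign ε ∈ {1, −1}, and set X := ⟨f_uu, ψ⟩, Y := ⟨f_uv, ψ⟩, Z := ⟨f_vv, ψ⟩. Then the following structure equations hold on U: f_uu = (E_u/(2E))·f_u + X·f_v − (E_v/2 + X·G)·ψ; f_uv = (E_v/(2E))·f_u + Y·f_v + (G_u/2 − Y·G)·ψ; f_vv = −(G_u/(2E))·f_u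 + Z·f_v + (G_v/2 − Z·G)·ψ; ψ_u = −(X/E)·f_u − Y·ψ; ψ_v = −(Y/E)·f_u − Z·ψ. -/
noncomputable section

open Topology

/-- A vector orthogonal to all three members of an adapted frame vanishes. -/
lemma eq_zero_of_mink_eq_zero_s9 {a b c w : Fin 3 → ℝ} (haa : 0 < mink a a)
    (hab : mink a b = 0) (hcc : mink c c = 0) (hca : mink c a = 0) (hcb : mink c b = 1)
    (hwa : mink w a = 0) (hwb : mink w b = 0) (hwc : mink w c = 0) : w = 0 := by
  simp only [mink] at *
  set d := a 0 * (b 1 * c 2 - b 2 * c 1) - a 1 * (b 0 * c 2 - b 2 * c 0)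
    + a 2 * (b 0 * c 1 - b 1 * c 0) with hd
  have hgram : d ^ 2 = a 0 * a 0 + a 1 * a 1 - a 2 * a 2 := by
    have key : -d ^ 2 =
        (a 0 * a 0 + a 1 * a 1 - a 2 * a 2) *
          ((b 0 * b 0 + b 1 * b 1 - b 2 * b 2) * (c 0 * c 0 + c 1 * c 1 - c 2 * c 2)
            - (c 0 * b 0 + c 1 * b 1 - c 2 * b 2) ^ 2)
        - (a 0 * b 0 + a 1 * b 1 - a 2 * b 2) *
          ((a 0 * b 0 + a 1 * b 1 - a 2 * b 2) * (c 0 * c 0 + c 1 * c 1 - c 2 * c 2)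
            - (c 0 * b 0 + c 1 * b 1 - c 2 * b 2) * (c 0 * a 0 + c 1 * a 1 - c 2 * a 2))
        + (c 0 * a 0 + c 1 * a 1 - c 2 * a 2) *
          ((a 0 * b 0 + a 1 * b 1 - a 2 * b 2) * (c 0 * b 0 + c 1 * b 1 - c 2 * b 2)
            - (b 0 * b 0 + b 1 * b 1 - b 2 * b 2) * (c 0 * a 0 + c 1 * a 1 - c 2 * a 2)) := by
      rw [hd]; ring
    rw [hab, hcc, hca, hcb] at key
    linarith
  have hd0 : d ≠ 0 := by
    intro h
    rw [h] at hgram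
    linarith
  have h0 : w 0 * d = 0 := by
    rw [hd]
    linear_combination (b 1 * c 2 - b 2 * c 1) * hwa + (c 1 * a 2 - c 2 * a 1) * hwb
      + (a 1 * b 2 - a 2 * b 1) * hwc
  have h1 : w 1 * d = 0 := by
    rw [hd]
    linear_combination (b 2 * c 0 - b 0 * c 2) * hwa + (c 2 * a 0 - c 0 * a 2) * hwb
      + (a 2 * b 0 - a 0 * b 2) * hwc
  have h2 : w 2 * d = 0 := by
    rw [hd]
    linear_combination -(b 0 * c 1 - b 1 * c 0) * hwa - (c 0 * a 1 - c 1 * a 0) * hwb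
      - (a 0 * b 1 - a 1 * b 0) * hwc
  ext i
  fin_cases i
  · exact (mul_eq_zero.1 h0).resolve_right hd0
  · exact (mul_eq_zero.1 h1).resolve_right hd0
  · exact (mul_eq_zero.1 h2).resolve_right hd0

/-- The expansion of a vector in an adapted frame in terms of its Minkowski products. -/
lemma eq_frame_expansion {a b c w : Fin 3 → ℝ} (haa : 0 < mink a a)
    (hab : mink a b = 0) (hcc : mink c c = 0) (hca : mink c a = 0) (hcb : mink c b = 1) :
    w = (mink w a / mink a a) • a + mink w c • b + (mink w b - mink w c * mink b b) • c := by
  have hlin (r s t : ℝ) (x : Fin 3 → ℝ) : mink (w - (r • a + s • b + t • c)) x =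
      mink w x - (r * mink a x + s * mink b x + t * mink c x) := by
    simp only [mink, Pi.sub_apply, Pi.add_apply, Pi.smul_apply, smul_eq_mul]; ring
  have hcomm (x y : Fin 3 → ℝ) : mink x y = mink y x := by simp only [mink]; ring
  refine sub_eq_zero.1 (eq_zero_of_mink_eq_zero_s9 haa hab hcc hca hcb ?_ ?_ ?_) <;> rw [hlin]
  · rw [hcomm b a, hab, hca]
    field_simp
    ring
  · rw [hab, hcb]; ring
  · rw [hcomm a c, hcomm b c, hca, hcb, hcc]; ring

/-- The product rule for the Minkowski inner product. -/
lemma fderiv_mink {V : Type*} [NormedAddCommGroup V] [NormedSpace ℝ V]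
    {a b : V → Fin 3 → ℝ} {q : V} (ha : DifferentiableAt ℝ a q)
    (hb : DifferentiableAt ℝ b q) (v : V) :
    fderiv ℝ (fun p => mink (a p) (b p)) q v =
      mink (fderiv ℝ a q v) (b q) + mink (a q) (fderiv ℝ b q v) := by
  have ha' := hasFDerivAt_pi'.1 ha.hasFDerivAt
  have hb' := hasFDerivAt_pi'.1 hb.hasFDerivAt
  have h : HasFDerivAt (fun p => mink (a p) (b p)) _ q :=
    (((ha' 0).mul (hb' 0)).add ((ha' 1).mul (hb' 1))).sub ((ha' 2).mul (hb' 2))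
  rw [h.fderiv]
  simp [mink]
  ring

/-- The derivative of a Minkowski product that is constant on an open set. -/
lemma mink_fderiv_add_eq_zero {V : Type*} [NormedAddCommGroup V] [NormedSpace ℝ V]
    {U : Set V} (hU : IsOpen U) {a b : V → Fin 3 → ℝ} {k : ℝ}
    (hab : ∀ p ∈ U, mink (a p) (b p) = k) {q : V} (hq : q ∈ U)
    (ha : DifferentiableAt ℝ a q) (hb : DifferentiableAt ℝ b q) (v : V) :
    mink (fderiv ℝ a q v) (b q) + mink (a q) (fderiv ℝ b q v) = 0 := by
  have h : (fun p => mink (a p) (b p)) =ᶠ[𝓝 q] fun _ => k :=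
    Filter.eventuallyEq_of_mem (hU.mem_nhds hq) hab
  rw [← fderiv_mink ha hb, h.fderiv_eq]
  simp

/-- The mixed second partial derivatives of a smooth map agree. -/
lemma pu_pv_eq_pv_pu {F : Type*} [NormedAddCommGroup F] [NormedSpace ℝ F]
    {f : ℝ × ℝ → F} {q : ℝ × ℝ} (hf : ContDiffAt ℝ 2 f q) :
    pu (pv f) q = pv (pu f) q := by
  have hd : DifferentiableAt ℝ (fderiv ℝ f) q :=
    (hf.fderiv_right (m := 1) (by norm_num)).differentiableAt (by norm_num)
  have hsymm : IsSymmSndFDerivAt ℝ f q := hf.isSymmSndFDerivAt (by simp)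
  have h (v w : ℝ × ℝ) :
      fderiv ℝ (fun p => fderiv ℝ f p w) q v = fderiv ℝ (fderiv ℝ f) q v w := by
    rw [fderiv_clm_apply hd (differentiableAt_const w)]
    simp
  exact (h _ _).trans ((hsymm _ _).trans (h _ _).symm)

/-- Structure equations for the adapted frame `(f_u, f_v, ψ)` of a
surface in L-coordinates with L-Gauss map `ψ`, where `X = ⟨f_uu, ψ⟩`,
`Y = ⟨f_uv, ψ⟩`, `Z = ⟨f_vv, ψ⟩`. -/
theorem structure_equations
    (U : Set (ℝ × ℝ)) (hU : IsOpen U)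
    (f : ℝ × ℝ → Fin 3 → ℝ) (hf : ContDiffOn ℝ (⊤ : ℕ∞) f U)
    (himm : ∀ q ∈ U, LinearIndependent ℝ ![pu f q, pv f q])
    (E G : ℝ × ℝ → ℝ)
    (hE : E = fun q => mink (pu f q) (pu f q))
    (hG : G = fun q => mink (pv f q) (pv f q))
    (hFzero : ∀ q ∈ U, mink (pu f q) (pv f q) = 0)
    (hEpos : ∀ q ∈ U, 0 < E q)
    (ε : ℝ) (hε : ε = 1 ∨ ε = -1)
    (ψ : ℝ × ℝ → Fin 3 → ℝ) (hψ : ContDiffOn ℝ (⊤ : ℕ∞) ψ U)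
    (hLG : ∀ q ∈ U, lcross (pu f q) (pv f q)
      = (ε * Real.sqrt (E q)) • (pv f q - G q • ψ q))
    (hψψ : ∀ q ∈ U, mink (ψ q) (ψ q) = 0)
    (hψu : ∀ q ∈ U, mink (ψ q) (pu f q) = 0)
    (hψv : ∀ q ∈ U, mink (ψ q) (pv f q) = 1)
    (X Y Z : ℝ × ℝ → ℝ)
    (hX : X = fun q => mink (pu (pu f) q) (ψ q))
    (hY : Y = fun q => mink (pv (pu f) q) (ψ q))
    (hZ : Z = fun q => mink (pv (pv f) q) (ψ q)) :
    ∀ q ∈ U,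
      pu (pu f) q = (pu E q / (2 * E q)) • pu f q + X q • pv f q
          - (pv E q / 2 + X q * G q) • ψ q ∧
      pv (pu f) q = (pv E q / (2 * E q)) • pu f q + Y q • pv f q
          + (pu G q / 2 - Y q * G q) • ψ q ∧
      pv (pv f) q = (-(pu G q / (2 * E q))) • pu f q + Z q • pv f q
          + (pv G q / 2 - Z q * G q) • ψ q ∧
      pu ψ q = (-(X q / E q)) • pu f q - Y q • ψ q ∧
      pv ψ q = (-(Y q / E q)) • pu f q - Z q • ψ q := by
  intro q hq
  have hfq : ContDiffAt ℝ 2 f q :=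
    (hf.contDiffAt (hU.mem_nhds hq)).of_le (WithTop.coe_le_coe.2 le_top)
  have hdf : DifferentiableAt ℝ (fderiv ℝ f) q :=
    (hfq.fderiv_right (m := 1) (by norm_num)).differentiableAt (by norm_num)
  have hdu : DifferentiableAt ℝ (pu f) q := hdf.clm_apply (differentiableAt_const _)
  have hdv : DifferentiableAt ℝ (pv f) q := hdf.clm_apply (differentiableAt_const _)
  have hdψ : DifferentiableAt ℝ ψ q :=
    (hψ.contDiffAt (hU.mem_nhds hq)).differentiableAt (by simp)
  have hcomm (x y : Fin 3 → ℝ) : mink x y = mink y x := by simp only [mink]; ring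
  have hmixed := pu_pv_eq_pv_pu hfq
  have hEu : pu E q = mink (pu (pu f) q) (pu f q) + mink (pu f q) (pu (pu f) q) := by
    rw [hE]; exact fderiv_mink hdu hdu _
  have hEv : pv E q = mink (pv (pu f) q) (pu f q) + mink (pu f q) (pv (pu f) q) := by
    rw [hE]; exact fderiv_mink hdu hdu _
  have hGu : pu G q = mink (pu (pv f) q) (pv f q) + mink (pv f q) (pu (pv f) q) := by
    rw [hG]; exact fderiv_mink hdv hdv _
  have hGv : pv G q = mink (pv (pv f) q) (pv f q) + mink (pv f q) (pv (pv f) q) := by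
    rw [hG]; exact fderiv_mink hdv hdv _
  have hFu : mink (pu (pu f) q) (pv f q) + mink (pu f q) (pu (pv f) q) = 0 :=
    mink_fderiv_add_eq_zero hU hFzero hq hdu hdv _
  have hFv : mink (pv (pu f) q) (pv f q) + mink (pu f q) (pv (pv f) q) = 0 :=
    mink_fderiv_add_eq_zero hU hFzero hq hdu hdv _
  have hψψu : mink (pu ψ q) (ψ q) + mink (ψ q) (pu ψ q) = 0 :=
    mink_fderiv_add_eq_zero hU hψψ hq hdψ hdψ _
  have hψψv : mink (pv ψ q) (ψ q) + mink (ψ q) (pv ψ q) = 0 :=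
    mink_fderiv_add_eq_zero hU hψψ hq hdψ hdψ _
  have hψuu : mink (pu ψ q) (pu f q) + mink (ψ q) (pu (pu f) q) = 0 :=
    mink_fderiv_add_eq_zero hU hψu hq hdψ hdu _
  have hψuv : mink (pv ψ q) (pu f q) + mink (ψ q) (pv (pu f) q) = 0 :=
    mink_fderiv_add_eq_zero hU hψu hq hdψ hdu _
  have hψvu : mink (pu ψ q) (pv f q) + mink (ψ q) (pu (pv f) q) = 0 :=
    mink_fderiv_add_eq_zero hU hψv hq hdψ hdv _
  have hψvv : mink (pv ψ q) (pv f q) + mink (ψ q) (pv (pv f) q) = 0 :=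
    mink_fderiv_add_eq_zero hU hψv hq hdψ hdv _
  rw [hmixed] at hGu hFu hψvu
  rw [hcomm (pu f q)] at hEu hEv hFu hFv
  rw [hcomm (pv f q)] at hGu hGv
  rw [hcomm (ψ q)] at hψψu hψψv hψuu hψuv hψvu hψvv
  have hEq : E q = mink (pu f q) (pu f q) := by rw [hE]
  have hGq : G q = mink (pv f q) (pv f q) := by rw [hG]
  have hXq : X q = mink (pu (pu f) q) (ψ q) := by rw [hX]
  have hYq : Y q = mink (pv (pu f) q) (ψ q) := by rw [hY]
  have hZq : Z q = mink (pv (pv f) q) (ψ q) := by rw [hZ]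
  have expand (w : Fin 3 → ℝ) {α β γ : ℝ} (hα : mink w (pu f q) = α)
      (hβ : mink w (ψ q) = β) (hγ : mink w (pv f q) = γ) :
      w = (α / E q) • pu f q + β • pv f q + (γ - β * G q) • ψ q := by
    rw [← hα, ← hβ, ← hγ, hEq, hGq]
    exact eq_frame_expansion (hEq ▸ hEpos q hq) (hFzero q hq) (hψψ q hq) (hψu q hq) (hψv q hq)
  refine ⟨?_, ?_, ?_, ?_, ?_⟩
  · rw [expand (pu (pu f) q) (α := pu E q / 2) (γ := -(pv E q / 2)) (by linarith) hXq.symm (by linarith)]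
    module
  · rw [expand (pv (pu f) q) (α := pv E q / 2) (γ := pu G q / 2) (by linarith) hYq.symm (by linarith)]
    module
  · rw [expand (pv (pv f) q) (α := -(pu G q / 2)) (γ := pv G q / 2) (by linarith) hZq.symm (by linarith)]
    module
  · rw [expand (pu ψ q) (α := -X q) (β := 0) (γ := -Y q) (by linarith) (by linarith) (by linarith)]
    module
  · rw [expand (pv ψ q) (α := -Y q) (β := 0) (γ := -Z q) (by linarith) (by linarith) (by linarith)]
    module
end
end

section
/- Let E, G, X, Y, Z : U → ℝ be smooth functions on an open set U ⊆ ℝ² with E > 0, and define the 3×3 matrix-valued functions 𝒰 with rows (E_u/(2E), E_v/(2E), −X/E), (X, Y, 0), (−E_v/2 − XG, G_u/2 − YG, −Y), and 𝒱 with rows (E_v/(2E), −G_u/(2E), −Y/E), (Y, Z, 0), (G_u/2 − YG, G_v/2 − ZG, −Z). Then the identity 𝒰_v − 𝒱_u = 𝒰𝒱 − 𝒱𝒰 (entrywise partial derivatives) holds on U if and only if the three Gauss–Codazzi equations (C1), (C2) and (G) hold on U. -/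
noncomputable section

theorem fderiv_div_apply {f e : ℝ × ℝ → ℝ} {q : ℝ × ℝ}
    (hf : DifferentiableAt ℝ f q) (he : DifferentiableAt ℝ e q) (h0 : e q ≠ 0) (w : ℝ × ℝ) :
    fderiv ℝ (fun r => f r / e r) q w
      = (fderiv ℝ f q w * e q - f q * fderiv ℝ e q w) / e q ^ 2 := by
  have hi : HasFDerivAt (fun r => (e r)⁻¹) (-(e q ^ 2)⁻¹ • fderiv ℝ e q) q :=
    (hasDerivAt_inv h0).comp_hasFDerivAt q he.hasFDerivAt
  simp only [div_eq_mul_inv]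
  rw [(hf.hasFDerivAt.fun_mul hi).fderiv]
  simp
  field_simp
  ring

theorem fderiv_div_two_mul_apply {f e : ℝ × ℝ → ℝ} {q : ℝ × ℝ}
    (hf : DifferentiableAt ℝ f q) (he : DifferentiableAt ℝ e q) (h0 : e q ≠ 0) (w : ℝ × ℝ) :
    fderiv ℝ (fun r => f r / (2 * e r)) q w
      = (fderiv ℝ f q w * e q - f q * fderiv ℝ e q w) / (2 * e q ^ 2) := by
  rw [fderiv_div_apply hf (he.const_mul 2) (mul_ne_zero two_ne_zero h0), fderiv_const_mul he]
  simp
  field_simp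

theorem fderiv_half_sub_mul_apply {f g h : ℝ × ℝ → ℝ} {q : ℝ × ℝ}
    (hf : DifferentiableAt ℝ f q) (hg : DifferentiableAt ℝ g q) (hh : DifferentiableAt ℝ h q)
    (w : ℝ × ℝ) :
    fderiv ℝ (fun r => f r / 2 - g r * h r) q w
      = fderiv ℝ f q w / 2 - (fderiv ℝ g q w * h q + g q * fderiv ℝ h q w) := by
  have h' := (hf.hasFDerivAt.mul_const (2⁻¹ : ℝ)).fun_sub (hg.hasFDerivAt.fun_mul hh.hasFDerivAt)
  simp only [div_eq_mul_inv]
  rw [HasFDerivAt.fderiv h']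
  simp
  ring

theorem differentiableAt_fderiv_apply {f : ℝ × ℝ → ℝ} {q : ℝ × ℝ}
    (hf : ContDiffAt ℝ 2 f q) (w : ℝ × ℝ) :
    DifferentiableAt ℝ (fun r => fderiv ℝ f r w) q :=
  ((hf.fderiv_right (m := 1) (by norm_num)).differentiableAt (by norm_num)).clm_apply
    (differentiableAt_const w)

theorem pv_pu_eq_pu_pv {f : ℝ × ℝ → ℝ} {q : ℝ × ℝ} (hf : ContDiffAt ℝ 2 f q) :
    pv (pu f) q = pu (pv f) q := by
  have hd : DifferentiableAt ℝ (fderiv ℝ f) q :=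
    (hf.fderiv_right (m := 1) (by norm_num)).differentiableAt (by norm_num)
  have hs := (hf.isSymmSndFDerivAt (by simp)).eq (0, 1) (1, 0)
  have key (w w' : ℝ × ℝ) :
      fderiv ℝ (fun r => fderiv ℝ f r w) q w' = fderiv ℝ (fderiv ℝ f) q w' w := by
    rw [fderiv_clm_apply hd (differentiableAt_const w)]
    simp
  change fderiv ℝ (fun r => fderiv ℝ f r (1, 0)) q (0, 1)
    = fderiv ℝ (fun r => fderiv ℝ f r (0, 1)) q (1, 0)
  rw [key, key, hs]

/-- The compatibility condition `𝒰_v − 𝒱_u = 𝒰𝒱 − 𝒱𝒰` for the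
matrices `𝒰`, `𝒱` of the adapted frame equations holds on `U` if and only if
the Gauss–Codazzi equations (C1), (C2), (G) hold on `U`. -/
theorem integrability_iff_gauss_codazzi
    (U : Set (ℝ × ℝ)) (hU : IsOpen U)
    (E G X Y Z : ℝ × ℝ → ℝ)
    (hE : ContDiffOn ℝ (⊤ : ℕ∞) E U)
    (hG : ContDiffOn ℝ (⊤ : ℕ∞) G U)
    (hX : ContDiffOn ℝ (⊤ : ℕ∞) X U)
    (hY : ContDiffOn ℝ (⊤ : ℕ∞) Y U)
    (hZ : ContDiffOn ℝ (⊤ : ℕ∞) Z U)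
    (hEpos : ∀ q ∈ U, 0 < E q)
    (𝒰 𝒱 : ℝ × ℝ → Matrix (Fin 3) (Fin 3) ℝ)
    (h𝒰 : 𝒰 = fun q =>
      !![pu E q / (2 * E q), pv E q / (2 * E q), -(X q / E q);
         X q, Y q, 0;
         -(pv E q) / 2 - X q * G q, pu G q / 2 - Y q * G q, -(Y q)])
    (h𝒱 : 𝒱 = fun q =>
      !![pv E q / (2 * E q), -(pu G q / (2 * E q)), -(Y q / E q);
         Y q, Z q, 0;
         pu G q / 2 - Y q * G q, pv G q / 2 - Z q * G q, -(Z q)]) :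
    (∀ q ∈ U,
        (Matrix.of fun i j => pv (fun r => 𝒰 r i j) q)
          - (Matrix.of fun i j => pu (fun r => 𝒱 r i j) q)
        = 𝒰 q * 𝒱 q - 𝒱 q * 𝒰 q)
    ↔ ((∀ q ∈ U, pv X q - pu Y q
          = (pv E q * X q - pu E q * Y q) / (2 * E q) + (Y q) ^ 2 - X q * Z q)
      ∧ (∀ q ∈ U, pv Y q - pu Z q
          = -((pu G q * X q + pv E q * Y q) / (2 * E q)))
      ∧ (∀ q ∈ U, pv (pv E) q + pu (pu G) q
            - (pu E q * pu G q + (pv E q) ^ 2) / (2 * E q)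
          = 2 * G q * (X q * Z q - (Y q) ^ 2)
            - pv G q * X q + 2 * pu G q * Y q + pv E q * Z q)) := by
  have two_le : (2 : WithTop ℕ∞) ≤ ((⊤ : ℕ∞) : WithTop ℕ∞) := 
    WithTop.coe_le_coe.2 (le_top : (2 : ℕ∞) ≤ ⊤)
  rw [← forall₂_and, ← forall₂_and]
  refine forall₂_congr fun q hq => ?_
  have hn := hU.mem_nhds hq
  have e2 : ContDiffAt ℝ 2 E q := (hE.contDiffAt hn).of_le two_le
  have g2 : ContDiffAt ℝ 2 G q := (hG.contDiffAt hn).of_le two_le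
  have de := e2.differentiableAt two_ne_zero
  have dg := g2.differentiableAt two_ne_zero
  have dx := ((hX.contDiffAt hn).of_le two_le).differentiableAt two_ne_zero
  have dy := ((hY.contDiffAt hn).of_le two_le).differentiableAt two_ne_zero
  have dz := ((hZ.contDiffAt hn).of_le two_le).differentiableAt two_ne_zero
  have deu : DifferentiableAt ℝ (pu E) q := differentiableAt_fderiv_apply e2 _
  have dev : DifferentiableAt ℝ (pv E) q := differentiableAt_fderiv_apply e2 _
  have dgu : DifferentiableAt ℝ (pu G) q := differentiableAt_fderiv_apply g2 _
  have dgv : DifferentiableAt ℝ (pv G) q := differentiableAt_fderiv_apply g2 _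
  have h0 : E q ≠ 0 := (hEpos q hq).ne'
  have se := pv_pu_eq_pu_pv e2
  have sg := pv_pu_eq_pu_pv g2
  have a00 : pv (fun r => 𝒰 r 0 0) q
      = (pv (pu E) q * E q - pu E q * pv E q) / (2 * E q ^ 2) := by
    subst h𝒰; exact fderiv_div_two_mul_apply deu de h0 _
  have a01 : pv (fun r => 𝒰 r 0 1) q
      = (pv (pv E) q * E q - pv E q * pv E q) / (2 * E q ^ 2) := by
    subst h𝒰; exact fderiv_div_two_mul_apply dev de h0 _
  have a02 : pv (fun r => 𝒰 r 0 2) q = -((pv X q * E q - X q * pv E q) / E q ^ 2) := by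
    subst h𝒰
    change fderiv ℝ (fun r => -(X r / E r)) q _ = _
    rw [fderiv_fun_neg, neg_apply, fderiv_div_apply dx de h0]; rfl
  have a10 : pv (fun r => 𝒰 r 1 0) q = pv X q := by subst h𝒰; rfl
  have a11 : pv (fun r => 𝒰 r 1 1) q = pv Y q := by subst h𝒰; rfl
  have a12 : pv (fun r => 𝒰 r 1 2) q = 0 := by
    subst h𝒰
    change fderiv ℝ (fun _ => (0 : ℝ)) q _ = _
    simp
  have a20 : pv (fun r => 𝒰 r 2 0) q
      = -(pv (pv E) q) / 2 - (pv X q * G q + X q * pv G q) := by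
    subst h𝒰
    change fderiv ℝ (fun r => -(pv E r) / 2 - X r * G r) q _ = _
    rw [fderiv_half_sub_mul_apply dev.fun_neg dx dg, fderiv_fun_neg]; rfl
  have a21 : pv (fun r => 𝒰 r 2 1) q
      = pv (pu G) q / 2 - (pv Y q * G q + Y q * pv G q) := by
    subst h𝒰; exact fderiv_half_sub_mul_apply dgu dy dg _
  have a22 : pv (fun r => 𝒰 r 2 2) q = -(pv Y q) := by
    subst h𝒰
    change fderiv ℝ (fun r => -(Y r)) q _ = _
    rw [fderiv_fun_neg]; rfl
  have b00 : pu (fun r => 𝒱 r 0 0) q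
      = (pu (pv E) q * E q - pv E q * pu E q) / (2 * E q ^ 2) := by
    subst h𝒱; exact fderiv_div_two_mul_apply dev de h0 _
  have b01 : pu (fun r => 𝒱 r 0 1) q
      = -((pu (pu G) q * E q - pu G q * pu E q) / (2 * E q ^ 2)) := by
    subst h𝒱
    change fderiv ℝ (fun r => -(pu G r / (2 * E r))) q _ = _
    rw [fderiv_fun_neg, neg_apply, fderiv_div_two_mul_apply dgu de h0]; rfl
  have b02 : pu (fun r => 𝒱 r 0 2) q = -((pu Y q * E q - Y q * pu E q) / E q ^ 2) := by
    subst h𝒱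
    change fderiv ℝ (fun r => -(Y r / E r)) q _ = _
    rw [fderiv_fun_neg, neg_apply, fderiv_div_apply dy de h0]; rfl
  have b10 : pu (fun r => 𝒱 r 1 0) q = pu Y q := by subst h𝒱; rfl
  have b11 : pu (fun r => 𝒱 r 1 1) q = pu Z q := by subst h𝒱; rfl
  have b12 : pu (fun r => 𝒱 r 1 2) q = 0 := by
    subst h𝒱
    change fderiv ℝ (fun _ => (0 : ℝ)) q _ = _
    simp
  have b20 : pu (fun r => 𝒱 r 2 0) q
      = pu (pu G) q / 2 - (pu Y q * G q + Y q * pu G q) := by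
    subst h𝒱; exact fderiv_half_sub_mul_apply dgu dy dg _
  have b21 : pu (fun r => 𝒱 r 2 1) q
      = pu (pv G) q / 2 - (pu Z q * G q + Z q * pu G q) := by
    subst h𝒱; exact fderiv_half_sub_mul_apply dgv dz dg _
  have b22 : pu (fun r => 𝒱 r 2 2) q = -(pu Z q) := by
    subst h𝒱
    change fderiv ℝ (fun r => -(Z r)) q _ = _
    rw [fderiv_fun_neg]; rfl
  have hUq := congrFun h𝒰 q
  have hVq := congrFun h𝒱 q
  rw [← Matrix.ext_iff]
  simp only [Fin.forall_fin_succ, Matrix.sub_apply, Matrix.of_apply, Fin.isValue,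
    Matrix.mul_apply, Fin.sum_univ_three, Fin.succ_zero_eq_one, Fin.succ_one_eq_two,
    IsEmpty.forall_iff, and_true, a00, a01, a02, a10, a11, a12, a20, a21, a22,
    b00, b01, b02, b10, b11, b12, b20, b21, b22, hUq, hVq, se, sg]
  simp only [Matrix.cons_val', Matrix.cons_val, Matrix.cons_val_zero, Matrix.cons_val_one]
  clear a00 a01 a02 a10 a11 a12 a20 a21 a22 b00 b01 b02 b10 b11 b12 b20 b21 b22 hUq hVq
  constructor
  · rintro ⟨⟨-, h01, -⟩, ⟨h10, h11, -⟩, -⟩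
    refine ⟨?_, ?_, ?_⟩
    · linear_combination h10
    · linear_combination h11
    · field_simp at h01 ⊢
      linear_combination h01
  · rintro ⟨c1, c2, g⟩
    refine ⟨⟨?_, ?_, ?_⟩, ⟨?_, ?_, ?_⟩, ?_, ?_, ?_⟩
    · field_simp
      ring
    · field_simp at g ⊢
      linear_combination g
    · field_simp at c1 ⊢
      linear_combination -c1
    · linear_combination c1
    · linear_combination c2
    · ring
    · linear_combination (-1 / 2) * g - G q * c1
    · linear_combination -(G q) * c2
    · linear_combination -c2
end
end
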